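/- arXiv:1112.4398 — 2 statements merged into one kernel-verified Lean document; each statement's English description precedes it below -/
import Mathlib

section
/- (Gradient estimate for Neumann eigenfunctions) Let n ≥ 1, let Ω ⊂ ℝⁿ be a nonempty bounded open convex set with smooth boundary, let F be a strongly convex Minkowski norm of class C³ on ℝⁿ∖{0}, let λ > 0, and let u be a nonconstant Neumann eigenfunction of the Finsler–Laplacian on Ω with eigenvalue λ, normalized so that sup_{closure(Ω)} |u| ≤ 1. Then F(∇u(x))² + λ u(x)² ≤ λ for every x ∈ closure(Ω); equivalently F(∇u)² ≤ λ(1 − u²) on closure(Ω). -/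
open Real
open scoped RealInnerProductSpace

noncomputable section

/-- The `i`-th partial derivative of `f : ℝⁿ → ℝ` at `x`. -/
def pd {n : ℕ} (f : EuclideanSpace ℝ (Fin n) → ℝ) (i : Fin n)
    (x : EuclideanSpace ℝ (Fin n)) : ℝ :=
  fderiv ℝ f x (EuclideanSpace.single i 1)

/-- `a_{ij}(ξ) = ∂²(½F²)/∂ξ_i∂ξ_j (ξ)`. -/
def aCoeff {n : ℕ} (F : EuclideanSpace ℝ (Fin n) → ℝ) (i j : Fin n)
    (ξ : EuclideanSpace ℝ (Fin n)) : ℝ :=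
  pd (pd (fun η => F η ^ 2 / 2) i) j ξ

/-- A Minkowski norm on ℝⁿ: nonnegative, convex, even, positively 1-homogeneous,
and positive away from the origin. -/
structure IsMinkowskiNorm {n : ℕ} (F : EuclideanSpace ℝ (Fin n) → ℝ) : Prop where
  nonneg : ∀ ξ, 0 ≤ F ξ
  convexOn : ConvexOn ℝ Set.univ F
  even : ∀ ξ, F (-ξ) = F ξ
  homog : ∀ (t : ℝ) (ξ : EuclideanSpace ℝ (Fin n)), F (t • ξ) = |t| * F ξ
  pos : ∀ ξ, ξ ≠ 0 → 0 < F ξ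

/-- A strongly convex Minkowski norm of class C³: additionally `F` is C³ away from
the origin and the Hessian of `F²` is positive definite away from the origin. -/
structure IsStronglyConvexMinkowskiNormC3 {n : ℕ}
    (F : EuclideanSpace ℝ (Fin n) → ℝ) extends IsMinkowskiNorm F : Prop where
  contDiff3 : ContDiffOn ℝ 3 F {(0 : EuclideanSpace ℝ (Fin n))}ᶜ
  posDef : ∀ ξ : EuclideanSpace ℝ (Fin n), ξ ≠ 0 →
    ∀ V : EuclideanSpace ℝ (Fin n), V ≠ 0 →
      0 < ∑ i, ∑ j, aCoeff F i j ξ * V i * V j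

/-- A set has smooth boundary: near each boundary point there is a smooth local defining
function with nonvanishing differential. -/
def HasSmoothBoundary {n : ℕ} (Ω : Set (EuclideanSpace ℝ (Fin n))) : Prop :=
  ∀ x ∈ frontier Ω, ∃ U ∈ nhds x, ∃ f : EuclideanSpace ℝ (Fin n) → ℝ,
    ContDiff ℝ (⊤ : ℕ∞) f ∧ (∀ y ∈ U, (y ∈ Ω ↔ f y < 0)) ∧
      ∀ y ∈ U, y ∈ frontier Ω → fderiv ℝ f y ≠ 0

/-- `u` is a Neumann eigenfunction of the Finsler–Laplacian on `Ω` with eigenvalue `lam`: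
`u` is C¹ on the closure, C² where the gradient does not vanish, solves
`Σ a_{ij}(∇u) u_{ij} = −λ u` there, `F(∇u)F_ξ(∇u)` is continuous, and the anisotropic
Neumann condition `⟨F_ξ(∇u), ν⟩ = 0` holds at boundary points with `∇u ≠ 0`, for any
outward normal `ν` of the convex body `closure Ω`. -/
structure IsNeumannEigenfunction {n : ℕ} (F : EuclideanSpace ℝ (Fin n) → ℝ)
    (Ω : Set (EuclideanSpace ℝ (Fin n))) (lam : ℝ)
    (u : EuclideanSpace ℝ (Fin n) → ℝ) : Prop where
  contDiff1 : ContDiffOn ℝ 1 u (closure Ω)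
  contDiff2 : ContDiffOn ℝ 2 u {x ∈ closure Ω | gradient u x ≠ 0}
  eqn : ∀ x ∈ Ω, gradient u x ≠ 0 →
    ∑ i, ∑ j, aCoeff F i j (gradient u x) * pd (pd u i) j x = -lam * u x
  fluxCont : ContinuousOn
    (fun x => F (gradient u x) • gradient F (gradient u x)) (closure Ω)
  neumann : ∀ x ∈ frontier Ω, gradient u x ≠ 0 →
    ∀ ν : EuclideanSpace ℝ (Fin n), ν ≠ 0 →
      (∀ y ∈ closure Ω, ⟪ν, y - x⟫ ≤ 0) →
      ⟪gradient F (gradient u x), ν⟫ = 0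

open Filter Topology Set

section DualNorm

variable {n : ℕ} {F : EuclideanSpace ℝ (Fin n) → ℝ}

/-- The dual norm `F°(z) = sup {⟪ξ, z⟫ | F ξ ≤ 1}`. -/
def dualNorm {n : ℕ} (F : EuclideanSpace ℝ (Fin n) → ℝ) (z : EuclideanSpace ℝ (Fin n)) : ℝ :=
  sSup ((fun ξ : EuclideanSpace ℝ (Fin n) => ⟪ξ, z⟫) '' {ξ | F ξ ≤ 1})

namespace IsMinkowskiNorm

lemma continuous (hF : IsMinkowskiNorm F) : Continuous F :=
  continuousOn_univ.1 (hF.convexOn.continuousOn isOpen_univ)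

lemma map_zero (hF : IsMinkowskiNorm F) : F 0 = 0 := by
  simpa using hF.homog 0 0

lemma add_le (hF : IsMinkowskiNorm F) (a b : EuclideanSpace ℝ (Fin n)) :
    F (a + b) ≤ F a + F b := by
  have h := hF.convexOn.2 (mem_univ ((2 : ℝ) • a)) (mem_univ ((2 : ℝ) • b))
    (by norm_num : (0 : ℝ) ≤ 1 / 2) (by norm_num : (0 : ℝ) ≤ 1 / 2) (by norm_num)
  rw [smul_smul, smul_smul, hF.homog, hF.homog] at h
  norm_num at h
  linarith

lemma exists_lower_bound (hF : IsMinkowskiNorm F) : ∃ c > 0, ∀ ξ, c * ‖ξ‖ ≤ F ξ := by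
  rcases (Metric.sphere (0 : EuclideanSpace ℝ (Fin n)) 1).eq_empty_or_nonempty with he | hne
  · refine ⟨1, one_pos, fun ξ => ?_⟩
    have h0 : ξ = 0 := by
      by_contra h
      have : ‖ξ‖⁻¹ • ξ ∈ Metric.sphere (0 : EuclideanSpace ℝ (Fin n)) 1 := by
        simp [norm_smul, h]
      rw [he] at this
      exact this
    simp [h0, hF.map_zero]
  · obtain ⟨m, hm, hmin⟩ := (isCompact_sphere (0 : EuclideanSpace ℝ (Fin n)) 1).exists_isMinOn
      hne hF.continuous.continuousOn
    have hm0 : m ≠ 0 := by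
      rintro rfl
      simp at hm
    refine ⟨F m, hF.pos m hm0, fun ξ => ?_⟩
    rcases eq_or_ne ξ 0 with rfl | h
    · simp [hF.map_zero]
    have hs : ‖ξ‖⁻¹ • ξ ∈ Metric.sphere (0 : EuclideanSpace ℝ (Fin n)) 1 := by
      simp [norm_smul, h]
    have h1 : F m ≤ F (‖ξ‖⁻¹ • ξ) := hmin hs
    have hp : 0 < ‖ξ‖ := norm_pos_iff.2 h
    rw [hF.homog, abs_of_pos (inv_pos.2 hp), inv_mul_eq_div, le_div_iff₀ hp] at h1
    exact h1

lemma exists_norm_bound (hF : IsMinkowskiNorm F) : ∃ M ≥ 0, ∀ ξ, F ξ ≤ 1 → ‖ξ‖ ≤ M := by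
  obtain ⟨c, hc, h⟩ := hF.exists_lower_bound
  refine ⟨1 / c, by positivity, fun ξ hξ => ?_⟩
  rw [le_div_iff₀ hc, mul_comm]
  exact (h ξ).trans hξ

lemma bddAbove_inner (hF : IsMinkowskiNorm F) (z : EuclideanSpace ℝ (Fin n)) :
    BddAbove ((fun ξ : EuclideanSpace ℝ (Fin n) => ⟪ξ, z⟫) '' {ξ | F ξ ≤ 1}) := by
  obtain ⟨M, -, hM⟩ := hF.exists_norm_bound
  refine ⟨M * ‖z‖, ?_⟩
  rintro _ ⟨ξ, hξ, rfl⟩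
  exact (real_inner_le_norm ξ z).trans (mul_le_mul_of_nonneg_right (hM ξ hξ) (norm_nonneg z))

lemma dualNorm_le (hF : IsMinkowskiNorm F) {z : EuclideanSpace ℝ (Fin n)} {c : ℝ}
    (h : ∀ ξ, F ξ ≤ 1 → ⟪ξ, z⟫ ≤ c) : dualNorm F z ≤ c := by
  refine csSup_le ⟨_, 0, by simp [hF.map_zero], rfl⟩ ?_
  rintro _ ⟨ξ, hξ, rfl⟩
  exact h ξ hξ

lemma inner_le_of_le_one (hF : IsMinkowskiNorm F) {ξ : EuclideanSpace ℝ (Fin n)} (h : F ξ ≤ 1)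
    (z : EuclideanSpace ℝ (Fin n)) : ⟪ξ, z⟫ ≤ dualNorm F z :=
  le_csSup (hF.bddAbove_inner z) ⟨ξ, h, rfl⟩

lemma inner_le (hF : IsMinkowskiNorm F) (ξ z : EuclideanSpace ℝ (Fin n)) :
    ⟪ξ, z⟫ ≤ F ξ * dualNorm F z := by
  rcases eq_or_ne ξ 0 with rfl | h
  · simp [hF.map_zero]
  have hp := hF.pos ξ h
  have h1 : F ((F ξ)⁻¹ • ξ) ≤ 1 := by
    rw [hF.homog, abs_of_pos (inv_pos.2 hp), inv_mul_cancel₀ hp.ne']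
  have h2 := hF.inner_le_of_le_one h1 z
  rwa [real_inner_smul_left, inv_mul_le_iff₀ hp] at h2

lemma dualNorm_nonneg (hF : IsMinkowskiNorm F) (z : EuclideanSpace ℝ (Fin n)) :
    0 ≤ dualNorm F z := by
  simpa using hF.inner_le_of_le_one (ξ := 0) (by simp [hF.map_zero]) z

lemma dualNorm_add_le (hF : IsMinkowskiNorm F) (a b : EuclideanSpace ℝ (Fin n)) :
    dualNorm F (a + b) ≤ dualNorm F a + dualNorm F b := by
  refine hF.dualNorm_le fun ξ hξ => ?_
  rw [inner_add_right]
  exact add_le_add (hF.inner_le_of_le_one hξ a) (hF.inner_le_of_le_one hξ b)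

lemma dualNorm_smul_le (hF : IsMinkowskiNorm F) {t : ℝ} (ht : 0 ≤ t)
    (z : EuclideanSpace ℝ (Fin n)) : dualNorm F (t • z) ≤ t * dualNorm F z := by
  refine hF.dualNorm_le fun ξ hξ => ?_
  rw [real_inner_smul_right]
  exact mul_le_mul_of_nonneg_left (hF.inner_le_of_le_one hξ z) ht

lemma dualNorm_zero (hF : IsMinkowskiNorm F) : dualNorm F 0 = 0 :=
  le_antisymm (hF.dualNorm_le fun ξ _ => by simp) (hF.dualNorm_nonneg 0)

lemma dualNorm_neg (hF : IsMinkowskiNorm F) (z : EuclideanSpace ℝ (Fin n)) :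
    dualNorm F (-z) = dualNorm F z := by
  have key : ∀ z, dualNorm F (-z) ≤ dualNorm F z := fun z => by
    refine hF.dualNorm_le fun ξ hξ => ?_
    rw [inner_neg_right, ← inner_neg_left]
    exact hF.inner_le_of_le_one (by rwa [hF.even]) z
  exact le_antisymm (key z) (by simpa using key (-z))

lemma continuous_dualNorm (hF : IsMinkowskiNorm F) : Continuous (dualNorm F) := by
  have : ConvexOn ℝ univ (dualNorm F) := by
    refine ⟨convex_univ, fun a _ b _ s t hs ht _ => ?_⟩
    exact (hF.dualNorm_add_le _ _).trans
      (add_le_add (hF.dualNorm_smul_le hs a) (hF.dualNorm_smul_le ht b))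
  exact continuousOn_univ.1 (this.continuousOn isOpen_univ)

lemma gradient_neg (hF : IsMinkowskiNorm F) (ξ : EuclideanSpace ℝ (Fin n)) :
    gradient F (-ξ) = -gradient F ξ := by
  have h : fderiv ℝ (fun η => F ((-1 : ℝ) • η)) ξ = (-1 : ℝ) • fderiv ℝ F ((-1 : ℝ) • ξ) :=
    fderiv_comp_smul ..
  have h2 : (fun η => F ((-1 : ℝ) • η)) = F := by
    ext η
    simp [hF.even]
  rw [h2] at h
  simp only [neg_smul, one_smul] at h
  simp [gradient, h]

lemma gradient_smul (hF : IsMinkowskiNorm F) {t : ℝ} (ht : 0 < t)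
    (ξ : EuclideanSpace ℝ (Fin n)) : gradient F (t • ξ) = gradient F ξ := by
  have h : fderiv ℝ (fun η => F (t • η)) ξ = t • fderiv ℝ F (t • ξ) :=
    fderiv_comp_smul ..
  have h2 : (fun η => F (t • η)) = t • F := by
    ext η
    simp [hF.homog, abs_of_pos ht]
  rw [h2, fderiv_const_smul_field] at h
  have h3 : fderiv ℝ F ξ = fderiv ℝ F (t • ξ) := smul_right_injective _ ht.ne' h
  simp [gradient, h3]

end IsMinkowskiNorm

namespace IsStronglyConvexMinkowskiNormC3

variable {ξ : EuclideanSpace ℝ (Fin n)}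

lemma contDiffAt (hF : IsStronglyConvexMinkowskiNormC3 F) (h : ξ ≠ 0) : ContDiffAt ℝ 3 F ξ :=
  hF.contDiff3.contDiffAt (isOpen_compl_singleton.mem_nhds h)

lemma hasGradientAt (hF : IsStronglyConvexMinkowskiNormC3 F) (h : ξ ≠ 0) :
    HasGradientAt F (gradient F ξ) ξ :=
  ((hF.contDiffAt h).differentiableAt (by norm_num)).hasGradientAt

lemma hasDerivAt_line (hF : IsStronglyConvexMinkowskiNormC3 F) (h : ξ ≠ 0)
    (η : EuclideanSpace ℝ (Fin n)) :
    HasDerivAt (fun t : ℝ => F (ξ + t • η)) ⟪gradient F ξ, η⟫ 0 := by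
  have h1 : HasFDerivAt F ((InnerProductSpace.toDual ℝ _) (gradient F ξ)) ξ :=
    (hF.hasGradientAt h).hasFDerivAt
  have h2 : HasDerivAt (fun t : ℝ => ξ + t • η) η 0 := by
    simpa using ((hasDerivAt_id (0 : ℝ)).smul_const η).const_add ξ
  have h3 : HasFDerivAt F ((InnerProductSpace.toDual ℝ _) (gradient F ξ)) (ξ + (0 : ℝ) • η) := by
    simpa using h1
  simpa [Function.comp_def] using h3.comp_hasDerivAt 0 h2

lemma gradient_inner_self (hF : IsStronglyConvexMinkowskiNormC3 F) (h : ξ ≠ 0) :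
    ⟪gradient F ξ, ξ⟫ = F ξ := by
  have h1 := hF.hasDerivAt_line h ξ
  have h2 : HasDerivAt (fun t : ℝ => (1 + t) * F ξ) (F ξ) 0 := by
    simpa using ((hasDerivAt_id (0 : ℝ)).const_add 1).mul_const (F ξ)
  refine h1.unique (h2.congr_of_eventuallyEq ?_)
  filter_upwards [eventually_gt_nhds (show (-1 : ℝ) < 0 by norm_num)] with t ht
  rw [show ξ + t • ξ = (1 + t) • ξ by rw [add_smul, one_smul], hF.homog,
    abs_of_pos (by linarith)]

lemma gradient_inner_le (hF : IsStronglyConvexMinkowskiNormC3 F) (h : ξ ≠ 0)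
    (η : EuclideanSpace ℝ (Fin n)) : ⟪gradient F ξ, η⟫ ≤ F η := by
  have h1 := (hF.hasDerivAt_line h η).tendsto_slope_zero_right
  refine le_of_tendsto h1 ?_
  filter_upwards [self_mem_nhdsWithin] with t ht
  have ht : 0 < t := ht
  have h2 := hF.add_le ξ (t • η)
  rw [hF.homog, abs_of_pos ht] at h2
  simp only [zero_add, zero_smul, add_zero, smul_eq_mul]
  rw [inv_mul_le_iff₀ ht]
  linarith

lemma dualNorm_gradient_le (hF : IsStronglyConvexMinkowskiNormC3 F) (h : ξ ≠ 0) :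
    dualNorm F (gradient F ξ) ≤ 1 :=
  hF.dualNorm_le fun η hη => by
    rw [real_inner_comm]
    exact (hF.gradient_inner_le h η).trans hη

/-- The equality case of the duality inequality `⟪ξ, z⟫ ≤ F ξ * F°(z)`. -/
lemma eq_of_inner_eq (hF : IsStronglyConvexMinkowskiNormC3 F) (h : ξ ≠ 0)
    {z : EuclideanSpace ℝ (Fin n)} (hz : ⟪ξ, z⟫ = F ξ * dualNorm F z) :
    z = dualNorm F z • gradient F ξ := by
  refine ext_inner_right ℝ fun η => ?_
  have h1 : HasDerivAt (fun t : ℝ => F (ξ + t • η) * dualNorm F z - ⟪ξ + t • η, z⟫)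
      (⟪gradient F ξ, η⟫ * dualNorm F z - ⟪η, z⟫) 0 := by
    refine ((hF.hasDerivAt_line h η).mul_const _).sub ?_
    simp only [inner_add_left, real_inner_smul_left]
    simpa using ((hasDerivAt_id (0 : ℝ)).mul_const ⟪η, z⟫).const_add ⟪ξ, z⟫
  have h2 : IsLocalMin (fun t : ℝ => F (ξ + t • η) * dualNorm F z - ⟪ξ + t • η, z⟫) 0 := by
    refine Eventually.of_forall fun t => ?_
    have := hF.inner_le (ξ + t • η) z
    simp only [zero_smul, add_zero, hz, sub_self]
    linarith
  have h3 := h2.hasDerivAt_eq_zero h1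
  rw [real_inner_smul_left, real_inner_comm]
  linarith

end IsStronglyConvexMinkowskiNormC3

end DualNorm

section Hessian

variable {n : ℕ} {F : EuclideanSpace ℝ (Fin n) → ℝ}

/-- Half the square of `F`. -/
def halfSq {n : ℕ} (F : EuclideanSpace ℝ (Fin n) → ℝ) (η : EuclideanSpace ℝ (Fin n)) : ℝ :=
  F η ^ 2 / 2

/-- Expansion of a bilinear form in the standard basis. -/
lemma sum_bilin_single {n : ℕ}
    (B : EuclideanSpace ℝ (Fin n) →L[ℝ] EuclideanSpace ℝ (Fin n) →L[ℝ] ℝ)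
    (v w : EuclideanSpace ℝ (Fin n)) :
    ∑ i, ∑ j, B (EuclideanSpace.single j 1) (EuclideanSpace.single i 1) * w i * v j = B v w := by
  have hs : ∀ x : EuclideanSpace ℝ (Fin n),
      x = ∑ i, x i • (EuclideanSpace.single i 1 : EuclideanSpace ℝ (Fin n)) := fun x => by
    ext k
    simp [Finset.sum_apply, Pi.single_apply]
  conv_rhs => rw [hs v, hs w]
  simp only [map_sum, map_smul, _root_.sum_apply, _root_.smul_apply, smul_eq_mul,
    Finset.mul_sum]
  refine Finset.sum_congr rfl fun i _ => Finset.sum_congr rfl fun j _ => ?_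
  ring

/-- A positive semidefinite symmetric matrix contracts a negative semidefinite bilinear form to a
nonpositive number. -/
lemma sum_mul_bilin_nonpos {n : ℕ} (a : Fin n → Fin n → ℝ) (hsymm : ∀ i j, a i j = a j i)
    (hpos : ∀ V : EuclideanSpace ℝ (Fin n), 0 ≤ ∑ i, ∑ j, a i j * V i * V j)
    (B : EuclideanSpace ℝ (Fin n) →L[ℝ] EuclideanSpace ℝ (Fin n) →L[ℝ] ℝ)
    (hB : ∀ v, B v v ≤ 0) :
    ∑ i, ∑ j, a i j * B (EuclideanSpace.single j 1) (EuclideanSpace.single i 1) ≤ 0 := by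
  have hps : (Matrix.of a).PosSemidef := by
    refine Matrix.PosSemidef.of_dotProduct_mulVec_nonneg ?_ fun x => ?_
    · ext i j
      simp [Matrix.conjTranspose, hsymm i j]
    · have := hpos (WithLp.toLp 2 x)
      simp only [dotProduct, Matrix.mulVec, Matrix.of_apply, Pi.star_apply, star_trivial,
        Finset.mul_sum]
      refine this.trans_eq (Finset.sum_congr rfl fun i _ => Finset.sum_congr rfl fun j _ => ?_)
      ring
  obtain ⟨m, v, hv⟩ := Matrix.posSemidef_iff_eq_sum_vecMulVec.1 hps
  have ha : ∀ i j, a i j = ∑ k, v k i * v k j := fun i j => by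
    have := congrFun (congrFun hv i) j
    simpa [Matrix.sum_apply, Matrix.vecMulVec_apply] using this
  calc ∑ i, ∑ j, a i j * B (EuclideanSpace.single j 1) (EuclideanSpace.single i 1)
      = ∑ k, B (WithLp.toLp 2 (v k)) (WithLp.toLp 2 (v k)) := by
        have hk : ∀ z : EuclideanSpace ℝ (Fin n), B z z = ∑ i, ∑ j,
            B (EuclideanSpace.single j 1) (EuclideanSpace.single i 1) * z i * z j :=
          fun z => (sum_bilin_single B z z).symm
        symm
        rw [Finset.sum_congr rfl fun k (_ : k ∈ Finset.univ) => hk (WithLp.toLp 2 (v k)),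
          Finset.sum_comm]
        refine Finset.sum_congr rfl fun i _ => ?_
        rw [Finset.sum_comm]
        refine Finset.sum_congr rfl fun j _ => ?_
        rw [ha, Finset.sum_mul]
        refine Finset.sum_congr rfl fun k _ => ?_
        ring
    _ ≤ 0 := Finset.sum_nonpos fun k _ => hB _

lemma pd_pd_eq {f : EuclideanSpace ℝ (Fin n) → ℝ} {x : EuclideanSpace ℝ (Fin n)}
    (h : DifferentiableAt ℝ (fderiv ℝ f) x) (i j : Fin n) :
    pd (pd f i) j x
      = fderiv ℝ (fderiv ℝ f) x (EuclideanSpace.single j 1) (EuclideanSpace.single i 1) := by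
  have := (h.hasFDerivAt.clm_apply
    (hasFDerivAt_const (EuclideanSpace.single i (1 : ℝ)) x)).fderiv
  simp only [pd]
  rw [show (pd f i) = fun y => fderiv ℝ f y (EuclideanSpace.single i 1) from rfl, this]
  simp

namespace IsStronglyConvexMinkowskiNormC3

variable {ξ : EuclideanSpace ℝ (Fin n)}

lemma contDiffAt_halfSq (hF : IsStronglyConvexMinkowskiNormC3 F) (h : ξ ≠ 0) :
    ContDiffAt ℝ 3 (halfSq F) ξ :=
  ((hF.contDiffAt h).pow 2).div_const 2

lemma contDiffAt_fderiv_halfSq (hF : IsStronglyConvexMinkowskiNormC3 F) (h : ξ ≠ 0) :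
    ContDiffAt ℝ 2 (fderiv ℝ (halfSq F)) ξ :=
  (hF.contDiffAt_halfSq h).fderiv_right (by norm_num)

lemma aCoeff_eq (hF : IsStronglyConvexMinkowskiNormC3 F) (h : ξ ≠ 0) (i j : Fin n) :
    aCoeff F i j ξ = fderiv ℝ (fderiv ℝ (halfSq F)) ξ
      (EuclideanSpace.single j 1) (EuclideanSpace.single i 1) :=
  pd_pd_eq ((hF.contDiffAt_fderiv_halfSq h).differentiableAt (by norm_num)) i j

lemma aCoeff_symm (hF : IsStronglyConvexMinkowskiNormC3 F) (h : ξ ≠ 0) (i j : Fin n) :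
    aCoeff F i j ξ = aCoeff F j i ξ := by
  rw [hF.aCoeff_eq h, hF.aCoeff_eq h]
  exact (hF.contDiffAt_halfSq h).isSymmSndFDerivAt (by simp; norm_num) _ _

lemma continuousAt_aCoeff (hF : IsStronglyConvexMinkowskiNormC3 F) (h : ξ ≠ 0) (i j : Fin n) :
    ContinuousAt (aCoeff F i j) ξ := by
  have h1 : ContinuousAt (fderiv ℝ (fderiv ℝ (halfSq F))) ξ :=
    ((hF.contDiffAt_fderiv_halfSq h).fderiv_right (m := 1) (by norm_num)).continuousAt
  have h2 : ContinuousAt (fun η => fderiv ℝ (fderiv ℝ (halfSq F)) η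
      (EuclideanSpace.single j 1) (EuclideanSpace.single i 1)) ξ :=
    (h1.clm_apply continuousAt_const).clm_apply continuousAt_const
  refine h2.congr ?_
  filter_upwards [isOpen_compl_singleton.mem_nhds h] with η hη
  exact (hF.aCoeff_eq hη i j).symm

lemma sum_aCoeff (hF : IsStronglyConvexMinkowskiNormC3 F) (h : ξ ≠ 0)
    (V : EuclideanSpace ℝ (Fin n)) :
    ∑ i, ∑ j, aCoeff F i j ξ * V i * V j = fderiv ℝ (fderiv ℝ (halfSq F)) ξ V V := by
  rw [← sum_bilin_single]
  simp_rw [hF.aCoeff_eq h]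

lemma sum_aCoeff_nonneg (hF : IsStronglyConvexMinkowskiNormC3 F) (h : ξ ≠ 0)
    (V : EuclideanSpace ℝ (Fin n)) : 0 ≤ ∑ i, ∑ j, aCoeff F i j ξ * V i * V j := by
  rcases eq_or_ne V 0 with rfl | hV
  · simp
  · exact (hF.posDef ξ h V hV).le

lemma fderiv_halfSq (hF : IsStronglyConvexMinkowskiNormC3 F) (h : ξ ≠ 0)
    (η : EuclideanSpace ℝ (Fin n)) :
    fderiv ℝ (halfSq F) ξ η = F ξ * ⟪gradient F ξ, η⟫ := by
  have h1 : HasFDerivAt F ((InnerProductSpace.toDual ℝ _) (gradient F ξ)) ξ :=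
    (hF.hasGradientAt h).hasFDerivAt
  have h2 := ((h1.pow 2).mul_const (1 / 2 : ℝ)).fderiv
  have h3 : halfSq F = fun y => F y ^ 2 * (1 / 2 : ℝ) := by
    ext y
    simp [halfSq]
    ring
  rw [h3, h2]
  simp
  ring

lemma fderiv_halfSq_smul (hF : IsStronglyConvexMinkowskiNormC3 F) {t : ℝ} (ht : t ≠ 0)
    (ξ : EuclideanSpace ℝ (Fin n)) :
    fderiv ℝ (halfSq F) (t • ξ) = t • fderiv ℝ (halfSq F) ξ := by
  have h : fderiv ℝ (fun η => halfSq F (t • η)) ξ = t • fderiv ℝ (halfSq F) (t • ξ) :=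
    fderiv_comp_smul ..
  have h2 : (fun η => halfSq F (t • η)) = (t ^ 2) • halfSq F := by
    ext η
    simp [halfSq, hF.homog, mul_pow]
    ring
  rw [h2, fderiv_const_smul_field, sq, mul_smul] at h
  exact (smul_right_injective _ ht h).symm

lemma aCoeff_smul (hF : IsStronglyConvexMinkowskiNormC3 F) {t : ℝ} (ht : t ≠ 0)
    (i j : Fin n) (h : ξ ≠ 0) : aCoeff F i j (t • ξ) = aCoeff F i j ξ := by
  have h1 : fderiv ℝ (fun η => fderiv ℝ (halfSq F) (t • η)) ξ
      = t • fderiv ℝ (fderiv ℝ (halfSq F)) (t • ξ) := fderiv_comp_smul ..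
  simp_rw [hF.fderiv_halfSq_smul ht] at h1
  rw [fderiv_fun_const_smul ((hF.contDiffAt_fderiv_halfSq h).differentiableAt (by norm_num))] at h1
  rw [hF.aCoeff_eq h, hF.aCoeff_eq (smul_ne_zero ht h), smul_right_injective _ ht h1]

lemma sum_aCoeff_self (hF : IsStronglyConvexMinkowskiNormC3 F) (h : ξ ≠ 0) :
    ∑ i, ∑ j, aCoeff F i j ξ * ξ i * ξ j = F ξ ^ 2 := by
  rw [hF.sum_aCoeff h]
  have h1 : HasFDerivAt (fderiv ℝ (halfSq F)) (fderiv ℝ (fderiv ℝ (halfSq F)) ξ) ξ :=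
    ((hF.contDiffAt_fderiv_halfSq h).differentiableAt (by norm_num)).hasFDerivAt
  have h2 : HasDerivAt (fun t : ℝ => t • ξ) ξ 1 := by
    simpa using (hasDerivAt_id (1 : ℝ)).smul_const ξ
  have h3 : HasDerivAt (fun t : ℝ => fderiv ℝ (halfSq F) (t • ξ))
      (fderiv ℝ (fderiv ℝ (halfSq F)) ξ ξ) 1 := by
    refine HasFDerivAt.comp_hasDerivAt 1 ?_ h2
    simpa using h1
  have h4 : HasDerivAt (fun t : ℝ => t • fderiv ℝ (halfSq F) ξ) (fderiv ℝ (halfSq F) ξ) 1 := by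
    simpa using (hasDerivAt_id (1 : ℝ)).smul_const (fderiv ℝ (halfSq F) ξ)
  have h5 := h3.unique (h4.congr_of_eventuallyEq (by
    filter_upwards [eventually_ne_nhds one_ne_zero] with t ht
    exact hF.fderiv_halfSq_smul ht ξ))
  rw [h5, hF.fderiv_halfSq h, hF.gradient_inner_self h, sq]

/-- On level sets of `F` the gradient of `F` is injective. -/
lemma eq_of_gradient_eq (hF : IsStronglyConvexMinkowskiNormC3 F) {η : EuclideanSpace ℝ (Fin n)}
    (h : ξ ≠ 0) (hη : η ≠ 0) (hv : F ξ = F η) (hg : gradient F ξ = gradient F η) : ξ = η := by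
  by_contra hne
  set d := η - ξ with hd
  have hd0 : d ≠ 0 := sub_ne_zero.2 (Ne.symm hne)
  have hdV : ⟪gradient F ξ, d⟫ = 0 := by
    rw [hd, inner_sub_right, hF.gradient_inner_self h, hg, hF.gradient_inner_self hη, hv, sub_self]
  have hconst : ∀ t ∈ Icc (0 : ℝ) 1, F (ξ + t • d) = F ξ := by
    intro t ht
    refine le_antisymm ?_ ?_
    · have := hF.convexOn.2 (mem_univ ξ) (mem_univ η) (sub_nonneg.2 ht.2) ht.1 (by ring)
      rw [← hv, ← add_smul] at this
      have e : ξ + t • d = (1 - t) • ξ + t • η := by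
        rw [hd, smul_sub, sub_smul, one_smul]
        abel
      rw [e]
      simpa using this
    · have := hF.gradient_inner_le h (ξ + t • d)
      rwa [inner_add_right, real_inner_smul_right, hdV, hF.gradient_inner_self h, mul_zero,
        add_zero] at this
  have h1 : HasFDerivAt (fderiv ℝ (halfSq F)) (fderiv ℝ (fderiv ℝ (halfSq F)) ξ) ξ :=
    ((hF.contDiffAt_fderiv_halfSq h).differentiableAt (by norm_num)).hasFDerivAt
  have h2 : ∀ t : ℝ, HasDerivAt (fun t : ℝ => ξ + t • d) d t := fun t => by
    simpa using ((hasDerivAt_id t).smul_const d).const_add ξ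
  have h3 : HasDerivAt (fun t : ℝ => fderiv ℝ (halfSq F) (ξ + t • d) d)
      (fderiv ℝ (fderiv ℝ (halfSq F)) ξ d d) 0 := by
    have : HasDerivAt (fun t : ℝ => fderiv ℝ (halfSq F) (ξ + t • d))
        (fderiv ℝ (fderiv ℝ (halfSq F)) ξ d) 0 := by
      refine HasFDerivAt.comp_hasDerivAt 0 ?_ (h2 0)
      simpa using h1
    simpa using this.clm_apply (hasDerivAt_const 0 d)
  have hzero : ∀ t ∈ Ico (0 : ℝ) 1, fderiv ℝ (halfSq F) (ξ + t • d) d = 0 := by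
    intro t ht
    rcases eq_or_lt_of_le ht.1 with rfl | htp
    · simp [hF.fderiv_halfSq h, hdV]
    have hne0 : ξ + t • d ≠ 0 := by
      intro h0
      have := hconst t ⟨ht.1, ht.2.le⟩
      rw [h0, hF.map_zero] at this
      exact (hF.pos ξ h).ne this
    have h4 : HasDerivAt (fun t : ℝ => halfSq F (ξ + t • d))
        (fderiv ℝ (halfSq F) (ξ + t • d) d) t :=
      HasFDerivAt.comp_hasDerivAt (f := fun t : ℝ => ξ + t • d) t
        ((hF.contDiffAt_halfSq hne0).differentiableAt (by norm_num)).hasFDerivAt (h2 t)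
    refine h4.unique ((hasDerivAt_const t (halfSq F ξ)).congr_of_eventuallyEq ?_)
    filter_upwards [Icc_mem_nhds htp ht.2] with s hs
    simp [halfSq, hconst s hs]
  have h5 : HasDerivWithinAt (fun t : ℝ => fderiv ℝ (halfSq F) (ξ + t • d) d) 0 (Ici 0) 0 := by
    refine (hasDerivWithinAt_const (0 : ℝ) (Ici 0) (0 : ℝ)).congr_of_eventuallyEq ?_
      (hzero 0 ⟨le_rfl, one_pos⟩)
    filter_upwards [Ico_mem_nhdsGE (zero_lt_one' ℝ)] with t ht
    exact hzero t ht
  have h6 : fderiv ℝ (fderiv ℝ (halfSq F)) ξ d d = 0 :=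
    (uniqueDiffOn_Ici (0 : ℝ) 0 self_mem_Ici).eq_deriv _ h3.hasDerivWithinAt h5
  have h7 := hF.posDef ξ h d hd0
  rw [hF.sum_aCoeff h, h6] at h7
  exact h7.false

end IsStronglyConvexMinkowskiNormC3

end Hessian

section ConvexGeometry

variable {n : ℕ} {F : EuclideanSpace ℝ (Fin n) → ℝ} {Ω C : Set (EuclideanSpace ℝ (Fin n))}
  {x y : EuclideanSpace ℝ (Fin n)}

/-- A direction that is nonpositive on the normal cone of a convex set lies in its closed tangent
cone. -/
lemma mem_closure_tangentCone_of_normal (hC : Convex ℝ C) (hy : y ∈ C)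
    {V : EuclideanSpace ℝ (Fin n)}
    (hV : ∀ ν : EuclideanSpace ℝ (Fin n), (∀ p ∈ C, ⟪ν, p - y⟫ ≤ 0) → ⟪V, ν⟫ ≤ 0) :
    V ∈ closure {d | ∃ t : ℝ, 0 ≤ t ∧ ∃ p ∈ C, d = t • (p - y)} := by
  set K := {d | ∃ t : ℝ, 0 ≤ t ∧ ∃ p ∈ C, d = t • (p - y)} with hK
  have hconv : Convex ℝ K := by
    rintro _ ⟨t, ht, p, hp, rfl⟩ _ ⟨s, hs, q, hq, rfl⟩ a b ha hb -
    have hat : 0 ≤ a * t := mul_nonneg ha ht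
    have hbs : 0 ≤ b * s := mul_nonneg hb hs
    rcases eq_or_lt_of_le (add_nonneg hat hbs) with h0 | h0
    · have h1 : a * t = 0 := by linarith
      have h2 : b * s = 0 := by linarith
      exact ⟨0, le_rfl, y, hy, by simp [smul_smul, h1, h2]⟩
    · refine ⟨a * t + b * s, h0.le, _, hC hp hq (div_nonneg hat h0.le) (div_nonneg hbs h0.le)
        (by rw [← add_div, div_self h0.ne']), ?_⟩
      match_scalars <;> field_simp
      ring
  by_contra hVK
  obtain ⟨f, s, hf, hfV⟩ := geometric_hahn_banach_closed_point hconv.closure isClosed_closure hVK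
  have hf' : ∀ t : ℝ, 0 ≤ t → ∀ p ∈ C, t * f (p - y) < s := fun t ht p hp => by
    have := hf _ (subset_closure ⟨t, ht, p, hp, rfl⟩)
    simpa using this
  have hs : 0 < s := by simpa using hf' 0 le_rfl y hy
  have hneg : ∀ p ∈ C, f (p - y) ≤ 0 := fun p hp => by
    by_contra! hpos
    have := hf' (s / f (p - y)) (by positivity) p hp
    rw [div_mul_cancel₀ _ hpos.ne'] at this
    exact this.false
  have h1 := hV ((InnerProductSpace.toDual ℝ _).symm f) (fun p hp => by
    rw [InnerProductSpace.toDual_symm_apply]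
    exact hneg p hp)
  rw [real_inner_comm, InnerProductSpace.toDual_symm_apply] at h1
  linarith

/-- A one-sided linear bound along a segment bounds the directional derivative. -/
lemma inner_le_of_segment (hC : Convex ℝ C) {w : EuclideanSpace ℝ (Fin n) → ℝ}
    {ξ p : EuclideanSpace ℝ (Fin n)} (hw : HasGradientWithinAt w ξ C y) (hy : y ∈ C) (hp : p ∈ C)
    {c : ℝ} (h : ∀ t ∈ Ioc (0 : ℝ) 1, w (y + t • (p - y)) ≤ w y + t * c) :
    ⟪ξ, p - y⟫ ≤ c := by
  have h1 : HasFDerivWithinAt w ((InnerProductSpace.toDual ℝ _) ξ) C (y + (0 : ℝ) • (p - y)) := by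
    simpa using hw.hasFDerivWithinAt
  have h2 : HasDerivWithinAt (fun t : ℝ => y + t • (p - y)) (p - y) (Icc 0 1) 0 := by
    simpa using (((hasDerivAt_id (0 : ℝ)).smul_const (p - y)).const_add y).hasDerivWithinAt
  have h3 : MapsTo (fun t : ℝ => y + t • (p - y)) (Icc 0 1) C := fun t ht =>
    hC.add_smul_sub_mem hy hp ht
  have h4 := (h1.comp_hasDerivWithinAt (0 : ℝ) h2 h3).mono_of_mem_nhdsWithin
    (Icc_mem_nhdsGE (zero_lt_one' ℝ))
  have h5 := (hasDerivWithinAt_iff_tendsto_slope' (by simp)).1 h4.Ioi_of_Ici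
  simp only [InnerProductSpace.toDual_apply_apply] at h5
  refine le_of_tendsto h5 ?_
  filter_upwards [Ioc_mem_nhdsGT (zero_lt_one' ℝ)] with t ht
  have := h t ht
  simp only [slope_def_field, Function.comp, zero_smul, add_zero, sub_zero]
  rw [div_le_iff₀ ht.1]
  linarith

lemma IsMinkowskiNorm.dualNorm_smul (hF : IsMinkowskiNorm F) {t : ℝ} (ht : 0 ≤ t)
    (z : EuclideanSpace ℝ (Fin n)) : dualNorm F (t • z) = t * dualNorm F z := by
  rcases eq_or_lt_of_le ht with rfl | ht
  · simp [hF.dualNorm_zero]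
  refine le_antisymm (hF.dualNorm_smul_le ht.le z) ?_
  have := hF.dualNorm_smul_le (inv_pos.2 ht).le (t • z)
  rwa [smul_smul, inv_mul_cancel₀ ht.ne', one_smul, le_inv_mul_iff₀ ht] at this

lemma IsMinkowskiNorm.dualNorm_pos (hF : IsMinkowskiNorm F) {z : EuclideanSpace ℝ (Fin n)}
    (hz : z ≠ 0) : 0 < dualNorm F z := by
  have h1 := hF.inner_le z z
  have h2 : 0 < ⟪z, z⟫ := real_inner_self_pos.2 hz
  exact pos_of_mul_pos_right (h2.trans_le h1) (hF.nonneg z)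

/-- First-order conditions at a maximum of `p ↦ w p - L * F°(p - x)` on a convex set, when `w`
satisfies the anisotropic Neumann condition. -/
lemma IsStronglyConvexMinkowskiNormC3.first_order (hF : IsStronglyConvexMinkowskiNormC3 F)
    (hC : Convex ℝ C) {w : EuclideanSpace ℝ (Fin n) → ℝ} {ξ : EuclideanSpace ℝ (Fin n)}
    (hx : x ∈ C) (hy : y ∈ C) (hxy : y - x ≠ 0) {L : ℝ} (hL : 0 < L)
    (hw : HasGradientWithinAt w ξ C y)
    (hmax : ∀ p ∈ C, w p - L * dualNorm F (p - x) ≤ w y - L * dualNorm F (y - x))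
    (hν : ξ ≠ 0 → ∀ ν : EuclideanSpace ℝ (Fin n), (∀ p ∈ C, ⟪ν, p - y⟫ ≤ 0) →
      ⟪gradient F ξ, ν⟫ = 0) :
    ξ ≠ 0 ∧ F ξ = L ∧ y - x = dualNorm F (y - x) • gradient F ξ := by
  have hpos := hF.dualNorm_pos hxy
  have hlow : L * dualNorm F (y - x) ≤ ⟪ξ, y - x⟫ := by
    have := inner_le_of_segment hC hw hy hx (c := -(L * dualNorm F (y - x))) fun t ht => by
      have h1 := hmax _ (hC.add_smul_sub_mem hy hx ⟨ht.1.le, ht.2⟩)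
      have h2 : y + t • (x - y) - x = (1 - t) • (y - x) := by module
      rw [h2, hF.dualNorm_smul (sub_nonneg.2 ht.2)] at h1
      linarith
    rw [← neg_sub y x, inner_neg_right] at this
    linarith
  have hξ : ξ ≠ 0 := by
    rintro rfl
    rw [inner_zero_left] at hlow
    exact (mul_pos hL hpos).not_ge hlow
  have hcone : ∀ d ∈ {d | ∃ t : ℝ, 0 ≤ t ∧ ∃ p ∈ C, d = t • (p - y)},
      ⟪ξ, d⟫ ≤ L * dualNorm F d := by
    rintro _ ⟨s, hs, p, hp, rfl⟩
    have := inner_le_of_segment hC hw hy hp (c := L * dualNorm F (p - y)) fun t ht => by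
      have h1 := hmax _ (hC.add_smul_sub_mem hy hp ⟨ht.1.le, ht.2⟩)
      have h2 : y + t • (p - y) - x = (y - x) + t • (p - y) := by abel
      have h3 := hF.dualNorm_add_le (y - x) (t • (p - y))
      rw [← h2, hF.dualNorm_smul ht.1.le] at h3
      nlinarith
    rw [real_inner_smul_right, hF.dualNorm_smul hs]
    nlinarith
  have hV := mem_closure_tangentCone_of_normal hC hy (V := gradient F ξ)
    fun ν h => (hν hξ ν h).le
  have hup : ⟪ξ, gradient F ξ⟫ ≤ L * dualNorm F (gradient F ξ) :=
    closure_minimal (s := {d | ∃ t : ℝ, 0 ≤ t ∧ ∃ p ∈ C, d = t • (p - y)}) hcone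
      (isClosed_le (continuous_const.inner continuous_id)
        (continuous_const.mul hF.continuous_dualNorm)) hV
  rw [real_inner_comm, hF.gradient_inner_self hξ] at hup
  have hFL : F ξ ≤ L := hup.trans (by nlinarith [hF.dualNorm_gradient_le hξ])
  have hdual := hF.inner_le ξ (y - x)
  have hEq : F ξ = L := le_antisymm hFL (le_of_mul_le_mul_right (hlow.trans hdual) hpos)
  refine ⟨hξ, hEq, hF.eq_of_inner_eq hξ (le_antisymm hdual ?_)⟩
  rw [hEq]
  exact hlow

/-- For a convex set with smooth boundary, every direction in the open half-space opposite to a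
normal points strictly inside. -/
lemma HasSmoothBoundary.eventually_mem (hop : IsOpen Ω) (hsb : HasSmoothBoundary Ω)
    (hx : x ∈ frontier Ω) {ν : EuclideanSpace ℝ (Fin n)}
    (hν : ∀ p ∈ closure Ω, ⟪ν, p - x⟫ ≤ 0) {v : EuclideanSpace ℝ (Fin n)} (hv : ⟪ν, v⟫ < 0) :
    ∀ᶠ t : ℝ in 𝓝[>] 0, x + t • v ∈ Ω := by
  obtain ⟨U, hU, f, hf, hfU, hdf⟩ := hsb x hx
  have hxU := mem_of_mem_nhds hU
  have hdx : fderiv ℝ f x ≠ 0 := hdf x hxU hx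
  have hfd : HasFDerivAt f (fderiv ℝ f x) x :=
    (hf.differentiable (by simp)).differentiableAt.hasFDerivAt
  have hxΩ : x ∉ Ω := by
    rw [hop.frontier_eq] at hx
    exact hx.2
  have hfx0 : 0 ≤ f x := not_lt.1 fun h => hxΩ ((hfU x hxU).2 h)
  have hfx1 : f x ≤ 0 := by
    have hcl : x ∈ closure Ω := frontier_subset_closure hx
    have : (𝓝[Ω] x).NeBot := mem_closure_iff_nhdsWithin_neBot.1 hcl
    refine le_of_tendsto (hf.continuous.continuousAt.tendsto.mono_left nhdsWithin_le_nhds :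
      Tendsto f (𝓝[Ω] x) (𝓝 (f x))) ?_
    filter_upwards [self_mem_nhdsWithin, nhdsWithin_le_nhds hU] with p hp hpU
    exact ((hfU p hpU).1 hp).le
  have hfx : f x = 0 := le_antisymm hfx1 hfx0
  have hin : ∀ d, fderiv ℝ f x d < 0 → ∀ᶠ t : ℝ in 𝓝[>] 0, x + t • d ∈ Ω := by
    intro d hd
    have h2 : HasDerivAt (fun t : ℝ => x + t • d) d 0 := by
      simpa using ((hasDerivAt_id (0 : ℝ)).smul_const d).const_add x
    have h3 : HasDerivAt (fun t : ℝ => f (x + t • d)) (fderiv ℝ f x d) 0 :=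
      HasFDerivAt.comp_hasDerivAt (f := fun t : ℝ => x + t • d) 0 (by simpa using hfd) h2
    have h4 : Tendsto (fun t : ℝ => x + t • d) (𝓝[>] 0) (𝓝 x) := by
      have := h2.continuousAt.tendsto.mono_left (nhdsWithin_le_nhds (s := Ioi 0))
      simpa using this
    filter_upwards [h3.tendsto_slope_zero_right.eventually (eventually_lt_nhds hd), h4 hU,
      self_mem_nhdsWithin] with t ht htU ht0
    have ht0 : 0 < t := ht0
    simp only [zero_add, zero_smul, add_zero, hfx, sub_zero, smul_eq_mul] at ht
    exact (hfU _ htU).2 (by simpa using (inv_mul_lt_iff₀ ht0).1 ht)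
  have hnorm : ∀ d, fderiv ℝ f x d < 0 → ⟪ν, d⟫ ≤ 0 := by
    intro d hd
    obtain ⟨t, ht, ht0⟩ := ((hin d hd).and self_mem_nhdsWithin).exists
    have := hν _ (subset_closure ht)
    rw [add_sub_cancel_left, real_inner_smul_right] at this
    exact nonpos_of_mul_nonpos_right this ht0
  obtain ⟨d, hd⟩ : ∃ d, fderiv ℝ f x d < 0 := by
    obtain ⟨d, hd⟩ := DFunLike.ne_iff.1 hdx
    rcases lt_or_gt_of_ne hd with h | h
    · exact ⟨d, h⟩
    · exact ⟨-d, by simpa using h⟩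
  refine hin v (not_le.1 fun hge => ?_)
  have hε : ∀ ε > 0, -⟪ν, v⟫ + ε * ⟪ν, d⟫ ≤ 0 := fun ε hε => by
    have := hnorm (-v + ε • d) (by
      simp only [map_add, map_neg, map_smul, smul_eq_mul]
      nlinarith)
    simpa [inner_add_right, real_inner_smul_right] using this
  have hlim : Tendsto (fun ε : ℝ => -⟪ν, v⟫ + ε * ⟪ν, d⟫) (𝓝[>] 0) (𝓝 (-⟪ν, v⟫ + 0 * ⟪ν, d⟫)) :=
    ((continuous_const.add (continuous_id.mul continuous_const)).tendsto 0).mono_left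
      nhdsWithin_le_nhds
  have := le_of_tendsto hlim (by filter_upwards [self_mem_nhdsWithin] with ε h using hε ε h)
  linarith

lemma eventually_mem_of_mem (hop : IsOpen Ω) (hx : x ∈ Ω) (v : EuclideanSpace ℝ (Fin n)) :
    ∀ᶠ t : ℝ in 𝓝[>] 0, x + t • v ∈ Ω := by
  have h : Continuous fun t : ℝ => x + t • v := by fun_prop
  exact nhdsWithin_le_nhds (h.continuousAt.preimage_mem_nhds (hop.mem_nhds (by simpa using hx)))

lemma exists_common_halfspace_of_frontier (hop : IsOpen Ω) (hconv : Convex ℝ Ω)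
    (hsb : HasSmoothBoundary Ω) (hx : x ∈ closure Ω) (hy : y ∈ frontier Ω)
    (hperp : ∀ ν : EuclideanSpace ℝ (Fin n), (∀ p ∈ closure Ω, ⟪ν, p - y⟫ ≤ 0) →
      ⟪ν, y - x⟫ = 0) :
    ∃ ν : EuclideanSpace ℝ (Fin n), ν ≠ 0 ∧ ∀ v, ⟪ν, v⟫ < 0 →
      (∀ᶠ t : ℝ in 𝓝[>] 0, x + t • v ∈ Ω) ∧ ∀ᶠ t : ℝ in 𝓝[>] 0, y + t • v ∈ Ω := by
  have hyΩ : y ∉ Ω := by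
    rw [hop.frontier_eq] at hy
    exact hy.2
  obtain ⟨f, hf⟩ := geometric_hahn_banach_open_point hconv hop hyΩ
  set ν := (InnerProductSpace.toDual ℝ (EuclideanSpace ℝ (Fin n))).symm f with hνdef
  have hνf : ∀ d, ⟪ν, d⟫ = f d := fun d => InnerProductSpace.toDual_symm_apply
  have hcl : ∀ p ∈ closure Ω, ⟪ν, p - y⟫ ≤ 0 := fun p hp => by
    have : f p ≤ f y := closure_minimal (fun q hq => (hf q hq).le)
      (isClosed_le f.continuous continuous_const) hp
    rw [hνf, map_sub]
    linarith
  have hxy : f x = f y := by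
    have := hperp ν hcl
    rw [hνf, map_sub] at this
    linarith
  have hxfr : x ∈ frontier Ω := by
    rw [hop.frontier_eq]
    exact ⟨hx, fun h => (hf x h).ne hxy⟩
  have hclx : ∀ p ∈ closure Ω, ⟪ν, p - x⟫ ≤ 0 := fun p hp => by
    have := hcl p hp
    rw [hνf, map_sub] at this ⊢
    linarith
  have hν0 : ν ≠ 0 := by
    intro h0
    obtain ⟨p, hp⟩ : Ω.Nonempty := closure_nonempty_iff.1 ⟨x, hx⟩
    have h1 := hf p hp
    rw [← hνf, ← hνf, h0] at h1
    simp at h1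
  exact ⟨ν, hν0, fun v hv => ⟨hsb.eventually_mem hop hxfr hclx hv,
    hsb.eventually_mem hop hy hcl hv⟩⟩

/-- If the segment between two distinct points of a smooth convex body is orthogonal to the normals
at its endpoints, then an open half-space of directions points inside at both endpoints. -/
lemma exists_common_halfspace (hop : IsOpen Ω) (hconv : Convex ℝ Ω)
    (hsb : HasSmoothBoundary Ω) (hx : x ∈ closure Ω) (hy : y ∈ closure Ω) (hxy : y - x ≠ 0)
    (hpx : ∀ ν : EuclideanSpace ℝ (Fin n), (∀ p ∈ closure Ω, ⟪ν, p - x⟫ ≤ 0) → ⟪ν, y - x⟫ = 0)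
    (hpy : ∀ ν : EuclideanSpace ℝ (Fin n), (∀ p ∈ closure Ω, ⟪ν, p - y⟫ ≤ 0) → ⟪ν, y - x⟫ = 0) :
    ∃ ν : EuclideanSpace ℝ (Fin n), ν ≠ 0 ∧ ∀ v, ⟪ν, v⟫ < 0 →
      (∀ᶠ t : ℝ in 𝓝[>] 0, x + t • v ∈ Ω) ∧ ∀ᶠ t : ℝ in 𝓝[>] 0, y + t • v ∈ Ω := by
  by_cases hyΩ : y ∈ Ω
  · by_cases hxΩ : x ∈ Ω
    · exact ⟨_, hxy, fun v _ => ⟨eventually_mem_of_mem hop hxΩ v, eventually_mem_of_mem hop hyΩ v⟩⟩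
    · have hxfr : x ∈ frontier Ω := by
        rw [hop.frontier_eq]
        exact ⟨hx, hxΩ⟩
      obtain ⟨ν, h0, h⟩ := exists_common_halfspace_of_frontier hop hconv hsb hy hxfr
        fun ν hν => by rw [← neg_sub, inner_neg_right, hpx ν hν, neg_zero]
      exact ⟨ν, h0, fun v hv => (h v hv).symm⟩
  · exact exists_common_halfspace_of_frontier hop hconv hsb hx
      (by rw [hop.frontier_eq]; exact ⟨hy, hyΩ⟩) hpy

/-- A quadratic form that is nonpositive on an open half-space is nonpositive. -/
lemma bilin_nonpos_of_halfspace {ν : EuclideanSpace ℝ (Fin n)} (hν : ν ≠ 0)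
    (B : EuclideanSpace ℝ (Fin n) →L[ℝ] EuclideanSpace ℝ (Fin n) →L[ℝ] ℝ)
    (h : ∀ v, ⟪ν, v⟫ < 0 → B v v ≤ 0) (v : EuclideanSpace ℝ (Fin n)) : B v v ≤ 0 := by
  have hle : ∀ v, ⟪ν, v⟫ ≤ 0 → B v v ≤ 0 := fun v hv => by
    have hlim : Tendsto (fun ε : ℝ => B (v - ε • ν) (v - ε • ν)) (𝓝[>] 0)
        (𝓝 (B (v - (0 : ℝ) • ν) (v - (0 : ℝ) • ν))) := by
      have : Continuous fun ε : ℝ => B (v - ε • ν) (v - ε • ν) := by fun_prop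
      exact (this.tendsto 0).mono_left nhdsWithin_le_nhds
    simp only [zero_smul, sub_zero] at hlim
    refine le_of_tendsto hlim ?_
    filter_upwards [self_mem_nhdsWithin] with ε hε
    refine h _ ?_
    have h1 : 0 < ε * ⟪ν, ν⟫ := mul_pos hε (real_inner_self_pos.2 hν)
    rw [inner_sub_right, real_inner_smul_right]
    linarith
  rcases le_total ⟪ν, v⟫ 0 with hv | hv
  · exact hle v hv
  · simpa using hle (-v) (by rw [inner_neg_right]; linarith)

end ConvexGeometry

section OneSided

lemma lt_of_deriv_pos_of_tendsto {f f' : ℝ → ℝ} {ε l : ℝ}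
    (hf : ∀ t ∈ Ioo 0 ε, HasDerivAt f (f' t) t) (hpos : ∀ t ∈ Ioo 0 ε, 0 < f' t)
    (hl : Tendsto f (𝓝[>] 0) (𝓝 l)) {t : ℝ} (ht : t ∈ Ioo 0 ε) : l < f t := by
  have hmono : StrictMonoOn f (Ioo 0 ε) := by
    refine strictMonoOn_of_deriv_pos (convex_Ioo 0 ε)
      (fun s hs => (hf s hs).continuousAt.continuousWithinAt) fun s hs => ?_
    rw [interior_Ioo] at hs
    rw [(hf s hs).deriv]
    exact hpos s hs
  have ht2 : t / 2 ∈ Ioo 0 ε := ⟨by linarith [ht.1], by linarith [ht.1, ht.2]⟩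
  refine lt_of_le_of_lt (le_of_tendsto hl ?_) (hmono ht2 ht (by linarith [ht.1]))
  filter_upwards [Ioo_mem_nhdsGT ht2.1] with s hs
  exact (hmono ⟨hs.1, hs.2.trans ht2.2⟩ ht2 hs.2).le

/-- One-sided second derivative test. -/
lemma second_deriv_nonpos_of_one_sided_max {g g₁ g₂ : ℝ → ℝ} {g₀ c : ℝ}
    (h1 : ∀ᶠ t in 𝓝[>] (0 : ℝ), HasDerivAt g (g₁ t) t)
    (h2 : ∀ᶠ t in 𝓝[>] (0 : ℝ), HasDerivAt g₁ (g₂ t) t)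
    (l0 : Tendsto g (𝓝[>] 0) (𝓝 g₀)) (l1 : Tendsto g₁ (𝓝[>] 0) (𝓝 0))
    (l2 : Tendsto g₂ (𝓝[>] 0) (𝓝 c)) (hmax : ∀ᶠ t in 𝓝[>] (0 : ℝ), g t ≤ g₀) : c ≤ 0 := by
  by_contra! hc
  obtain ⟨ε, hε, H⟩ := (mem_nhdsGT_iff_exists_Ioo_subset.1
    (((h1.and h2).and (l2.eventually (eventually_gt_nhds hc))).and hmax))
  have hg1 : ∀ t ∈ Ioo 0 ε, 0 < g₁ t := fun t ht =>
    lt_of_deriv_pos_of_tendsto (fun s hs => (H hs).1.1.2) (fun s hs => (H hs).1.2) l1 ht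
  have hmid : ε / 2 ∈ Ioo 0 ε := ⟨half_pos hε, half_lt_self hε⟩
  exact (lt_of_deriv_pos_of_tendsto (fun s hs => (H hs).1.1.1) hg1 l0 hmid).not_ge (H hmid).2

end OneSided

section ArcsinChange

/-- The derivative of `r ↦ arcsin (r / σ)`. -/
def arcsinSlope (σ r : ℝ) : ℝ := (√(σ ^ 2 - r ^ 2))⁻¹

variable {σ r : ℝ}

lemma sq_sub_sq_pos_of_abs_lt (hr : |r| < σ) : 0 < σ ^ 2 - r ^ 2 :=
  sub_pos.2 (sq_lt_sq' (abs_lt.1 hr).1 (abs_lt.1 hr).2)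

lemma arcsinSlope_pos (hr : |r| < σ) : 0 < arcsinSlope σ r :=
  inv_pos.2 (Real.sqrt_pos.2 (sq_sub_sq_pos_of_abs_lt hr))

lemma arcsinSlope_sq (hr : |r| < σ) : arcsinSlope σ r ^ 2 = (σ ^ 2 - r ^ 2)⁻¹ := by
  rw [arcsinSlope, inv_pow, Real.sq_sqrt (sq_sub_sq_pos_of_abs_lt hr).le]

lemma hasDerivAt_arcsin_div (hr : |r| < σ) :
    HasDerivAt (fun r => arcsin (r / σ)) (arcsinSlope σ r) r := by
  have hσ : 0 < σ := (abs_nonneg r).trans_lt hr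
  have h1 : |r / σ| < 1 := by
    rwa [abs_div, abs_of_pos hσ, div_lt_one hσ]
  have h2 := (Real.hasDerivAt_arcsin (abs_lt.1 h1).1.ne' (abs_lt.1 h1).2.ne).comp r
    ((hasDerivAt_id r).div_const σ)
  have h3 : √(1 - (r / σ) ^ 2) = √(σ ^ 2 - r ^ 2) / σ := by
    rw [show 1 - (r / σ) ^ 2 = (σ ^ 2 - r ^ 2) / σ ^ 2 by field_simp,
      Real.sqrt_div (sq_sub_sq_pos_of_abs_lt hr).le, Real.sqrt_sq hσ.le]
  refine HasDerivAt.congr_deriv (f := fun r => arcsin (r / σ)) h2 ?_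
  have := (Real.sqrt_pos.2 (sq_sub_sq_pos_of_abs_lt hr)).ne'
  simp only [h3, arcsinSlope]
  field_simp

lemma hasDerivAt_arcsinSlope (hr : |r| < σ) :
    HasDerivAt (arcsinSlope σ) (r * arcsinSlope σ r ^ 3) r := by
  have h0 := sq_sub_sq_pos_of_abs_lt hr
  have h1 : HasDerivAt (fun r => σ ^ 2 - r ^ 2) (-(2 * r)) r := by
    simpa using (hasDerivAt_pow 2 r).const_sub (σ ^ 2)
  have h2 := (h1.sqrt h0.ne').inv (Real.sqrt_pos.2 h0).ne'
  refine HasDerivAt.congr_deriv (f := arcsinSlope σ) h2 ?_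
  have := (Real.sqrt_pos.2 h0).ne'
  simp only [arcsinSlope]
  field_simp

lemma strictMonoOn_arcsinSlope_mul : StrictMonoOn (fun r => arcsinSlope σ r * r) (Ioo (-σ) σ) := by
  have hd : ∀ r ∈ Ioo (-σ) σ, HasDerivAt (fun r => arcsinSlope σ r * r)
      (r * arcsinSlope σ r ^ 3 * r + arcsinSlope σ r * 1) r := fun r hr =>
    (hasDerivAt_arcsinSlope (abs_lt.2 hr)).mul (hasDerivAt_id r)
  refine strictMonoOn_of_deriv_pos (convex_Ioo _ _)
    (fun r hr => (hd r hr).continuousAt.continuousWithinAt) fun r hr => ?_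
  rw [interior_Ioo] at hr
  rw [(hd r hr).deriv]
  have := arcsinSlope_pos (abs_lt.2 hr)
  have h2 : 0 ≤ r * arcsinSlope σ r ^ 3 * r := by
    have : 0 ≤ r ^ 2 * arcsinSlope σ r ^ 3 := by positivity
    linarith
  linarith

end ArcsinChange

lemma Filter.Tendsto.continuousLinearMap_apply {ι E G : Type*} [NormedAddCommGroup E]
    [NormedSpace ℝ E] [NormedAddCommGroup G] [NormedSpace ℝ G] {l : Filter ι} {f : ι → E →L[ℝ] G}
    {a : E →L[ℝ] G} (h : Tendsto f l (𝓝 a)) (v : E) :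
    Tendsto (fun i => f i v) l (𝓝 (a v)) :=
  ((ContinuousLinearMap.apply ℝ G v).continuous.tendsto a).comp h

section Path

variable {n : ℕ} {u : EuclideanSpace ℝ (Fin n) → ℝ} {Ω : Set (EuclideanSpace ℝ (Fin n))}
  {y : EuclideanSpace ℝ (Fin n)}
  {B : EuclideanSpace ℝ (Fin n) →L[ℝ] EuclideanSpace ℝ (Fin n) →L[ℝ] ℝ}

/-- `u` and its first two derivatives on `Ω` have limits at `y`, the limits of `u` and of its first
derivative being their values at `y` and that of the second derivative being `B`. -/
structure HasSecondOrderLimit {n : ℕ} (u : EuclideanSpace ℝ (Fin n) → ℝ)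
    (Ω : Set (EuclideanSpace ℝ (Fin n))) (y : EuclideanSpace ℝ (Fin n))
    (B : EuclideanSpace ℝ (Fin n) →L[ℝ] EuclideanSpace ℝ (Fin n) →L[ℝ] ℝ) : Prop where
  tendsto : Tendsto u (𝓝[Ω] y) (𝓝 (u y))
  tendsto_fderiv : Tendsto (fderiv ℝ u) (𝓝[Ω] y) (𝓝 (fderiv ℝ u y))
  tendsto_fderiv_fderiv : Tendsto (fderiv ℝ (fderiv ℝ u)) (𝓝[Ω] y) (𝓝 B)
  differentiableAt : ∀ᶠ p in 𝓝[Ω] y,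
    DifferentiableAt ℝ u p ∧ DifferentiableAt ℝ (fderiv ℝ u) p

/-- One-sided derivatives of `arcsin (u / σ)` along a ray entering `Ω`. -/
lemma HasSecondOrderLimit.arcsin_path (hB : HasSecondOrderLimit u Ω y B) {σ : ℝ}
    (hσ : ∀ p ∈ Ω, |u p| < σ) (hσy : |u y| < σ) {v : EuclideanSpace ℝ (Fin n)}
    (hv : ∀ᶠ t : ℝ in 𝓝[>] 0, y + t • v ∈ Ω) :
    ∃ g₁ g₂ : ℝ → ℝ,
      (∀ᶠ t in 𝓝[>] (0 : ℝ), HasDerivAt (fun t : ℝ => arcsin (u (y + t • v) / σ)) (g₁ t) t) ∧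
      (∀ᶠ t in 𝓝[>] (0 : ℝ), HasDerivAt g₁ (g₂ t) t) ∧
      Tendsto (fun t : ℝ => arcsin (u (y + t • v) / σ)) (𝓝[>] 0) (𝓝 (arcsin (u y / σ))) ∧
      Tendsto g₁ (𝓝[>] 0) (𝓝 (arcsinSlope σ (u y) * fderiv ℝ u y v)) ∧
      Tendsto g₂ (𝓝[>] 0) (𝓝 (arcsinSlope σ (u y) * B v v
        + u y * arcsinSlope σ (u y) ^ 3 * fderiv ℝ u y v ^ 2)) := by
  have hline : ∀ t : ℝ, HasDerivAt (fun t : ℝ => y + t • v) v t := fun t => by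
    simpa using ((hasDerivAt_id t).smul_const v).const_add y
  have hpath : Tendsto (fun t : ℝ => y + t • v) (𝓝[>] 0) (𝓝[Ω] y) := by
    refine tendsto_nhdsWithin_iff.2 ⟨?_, hv⟩
    have := (hline 0).continuousAt.tendsto.mono_left (nhdsWithin_le_nhds (s := Ioi 0))
    simpa using this
  have lu := hB.tendsto.comp hpath
  have ldu : Tendsto (fun t : ℝ => fderiv ℝ u (y + t • v) v) (𝓝[>] 0) (𝓝 (fderiv ℝ u y v)) :=
    Tendsto.continuousLinearMap_apply (hB.tendsto_fderiv.comp hpath) v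
  have lddu : Tendsto (fun t : ℝ => fderiv ℝ (fderiv ℝ u) (y + t • v) v v) (𝓝[>] 0)
      (𝓝 (B v v)) :=
    Tendsto.continuousLinearMap_apply
      (Tendsto.continuousLinearMap_apply (hB.tendsto_fderiv_fderiv.comp hpath) v) v
  have lk : Tendsto (fun t : ℝ => arcsinSlope σ (u (y + t • v))) (𝓝[>] 0)
      (𝓝 (arcsinSlope σ (u y))) :=
    (hasDerivAt_arcsinSlope hσy).continuousAt.tendsto.comp lu
  have hdu : ∀ t : ℝ, DifferentiableAt ℝ u (y + t • v) →
      HasDerivAt (fun t : ℝ => u (y + t • v)) (fderiv ℝ u (y + t • v) v) t := fun t h =>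
    HasFDerivAt.comp_hasDerivAt (f := fun t : ℝ => y + t • v) t h.hasFDerivAt (hline t)
  refine ⟨fun t => arcsinSlope σ (u (y + t • v)) * fderiv ℝ u (y + t • v) v,
    fun t => arcsinSlope σ (u (y + t • v)) * fderiv ℝ (fderiv ℝ u) (y + t • v) v v
      + u (y + t • v) * arcsinSlope σ (u (y + t • v)) ^ 3 * fderiv ℝ u (y + t • v) v ^ 2,
    ?_, ?_, ?_, lk.mul ldu, (lk.mul lddu).add ((lu.mul (lk.pow 3)).mul (ldu.pow 2))⟩
  · filter_upwards [hv, hpath.eventually hB.differentiableAt] with t ht hd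
    exact (hasDerivAt_arcsin_div (hσ _ ht)).comp t (hdu t hd.1)
  · filter_upwards [hv, hpath.eventually hB.differentiableAt] with t ht hd
    have h1 : HasDerivAt (fun t : ℝ => arcsinSlope σ (u (y + t • v))) _ t :=
      HasDerivAt.comp (h₂ := arcsinSlope σ) (h := fun t : ℝ => u (y + t • v)) t
        (hasDerivAt_arcsinSlope (hσ _ ht)) (hdu t hd.1)
    have h2 : HasDerivAt (fun t : ℝ => fderiv ℝ u (y + t • v))
        (fderiv ℝ (fderiv ℝ u) (y + t • v) v) t :=
      HasFDerivAt.comp_hasDerivAt (f := fun t : ℝ => y + t • v) t hd.2.hasFDerivAt (hline t)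
    have h3 : HasDerivAt (fun t : ℝ => fderiv ℝ u (y + t • v) v)
        (fderiv ℝ (fderiv ℝ u) (y + t • v) v v) t := by
      simpa using h2.clm_apply (hasDerivAt_const t v)
    refine (h1.mul h3).congr_deriv ?_
    ring
  · exact (hasDerivAt_arcsin_div hσy).continuousAt.tendsto.comp lu

end Path

section Regularity

variable {n : ℕ} {F u : EuclideanSpace ℝ (Fin n) → ℝ} {Ω : Set (EuclideanSpace ℝ (Fin n))}
  {lam : ℝ}

lemma inner_gradient_eq (u : EuclideanSpace ℝ (Fin n) → ℝ) (x v : EuclideanSpace ℝ (Fin n)) :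
    ⟪gradient u x, v⟫ = fderiv ℝ u x v := by
  rw [gradient, InnerProductSpace.toDual_symm_apply]

lemma uniqueDiffOn_closure_of_convex (hop : IsOpen Ω) (hne : Ω.Nonempty) (hconv : Convex ℝ Ω) :
    UniqueDiffOn ℝ (closure Ω) :=
  uniqueDiffOn_convex hconv.closure
    (hne.mono (interior_maximal subset_closure hop))

namespace IsNeumannEigenfunction

/-- Continuity of the flux forces the ambient derivative at the boundary to agree with the
derivative within the closed domain. -/
lemma fderivWithin_eq (hF : IsStronglyConvexMinkowskiNormC3 F)
    (hu : IsNeumannEigenfunction F Ω lam u) (hop : IsOpen Ω) (hne : Ω.Nonempty)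
    (hconv : Convex ℝ Ω) {x : EuclideanSpace ℝ (Fin n)} (hx : x ∈ closure Ω) :
    fderivWithin ℝ u (closure Ω) x = fderiv ℝ u x := by
  have hud := uniqueDiffOn_closure_of_convex hop hne hconv
  by_cases hd : DifferentiableAt ℝ u x
  · exact hd.fderivWithin (hud x hx)
  rw [fderiv_zero_of_not_differentiableAt hd]
  have hgx : gradient u x = 0 := gradient_eq_zero_of_not_differentiableAt hd
  set G : EuclideanSpace ℝ (Fin n) → EuclideanSpace ℝ (Fin n) :=
    fun y => (InnerProductSpace.toDual ℝ _).symm (fderivWithin ℝ u (closure Ω) y) with hG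
  have hGc : ContinuousOn G (closure Ω) :=
    (LinearIsometryEquiv.continuous _).comp_continuousOn
      (hu.contDiff1.continuousOn_fderivWithin hud le_rfl)
  suffices hGx : G x = 0 by
    simpa [hG] using hGx
  by_contra hGx
  have : (𝓝[Ω] x).NeBot := mem_closure_iff_nhdsWithin_neBot.1 hx
  have hGlim : Tendsto G (𝓝[Ω] x) (𝓝 (G x)) :=
    (hGc x hx).mono_left (nhdsWithin_mono x subset_closure)
  have hgrad : gradient u =ᶠ[𝓝[Ω] x] G := by
    filter_upwards [self_mem_nhdsWithin] with p hp
    rw [hG]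
    simp only [gradient]
    rw [fderivWithin_of_mem_nhds (mem_of_superset (hop.mem_nhds hp) subset_closure)]
  have hfluxAt : ContinuousAt (fun ξ => F ξ • gradient F ξ) (G x) := by
    refine hF.continuous.continuousAt.smul ?_
    exact (LinearIsometryEquiv.continuous _).continuousAt.comp
      (((hF.contDiffAt hGx).fderiv_right (m := 2) (by norm_num)).continuousAt)
  have l1 : Tendsto (fun y => F (gradient u y) • gradient F (gradient u y)) (𝓝[Ω] x)
      (𝓝 (F (G x) • gradient F (G x))) :=
    (hfluxAt.tendsto.comp hGlim).congr' (by
      filter_upwards [hgrad] with p hp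
      simp [hp])
  have l2 : Tendsto (fun y => F (gradient u y) • gradient F (gradient u y)) (𝓝[Ω] x) (𝓝 0) := by
    have := (hu.fluxCont x hx).mono_left (nhdsWithin_mono x (subset_closure (s := Ω)))
    simpa [hgx, hF.map_zero] using this
  have h0 := tendsto_nhds_unique l1 l2
  have h1 : ⟪F (G x) • gradient F (G x), G x⟫ = 0 := by rw [h0, inner_zero_left]
  rw [real_inner_smul_left, hF.gradient_inner_self hGx] at h1
  have := hF.pos _ hGx
  exact (mul_pos this this).ne' h1

lemma continuousOn_fderiv (hF : IsStronglyConvexMinkowskiNormC3 F)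
    (hu : IsNeumannEigenfunction F Ω lam u) (hop : IsOpen Ω) (hne : Ω.Nonempty)
    (hconv : Convex ℝ Ω) : ContinuousOn (fderiv ℝ u) (closure Ω) :=
  (hu.contDiff1.continuousOn_fderivWithin
    (uniqueDiffOn_closure_of_convex hop hne hconv) le_rfl).congr
    fun _ hx => (hu.fderivWithin_eq hF hop hne hconv hx).symm

lemma continuousOn_gradient (hF : IsStronglyConvexMinkowskiNormC3 F)
    (hu : IsNeumannEigenfunction F Ω lam u) (hop : IsOpen Ω) (hne : Ω.Nonempty)
    (hconv : Convex ℝ Ω) : ContinuousOn (gradient u) (closure Ω) :=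
  (LinearIsometryEquiv.continuous _).comp_continuousOn (hu.continuousOn_fderiv hF hop hne hconv)

lemma hasGradientWithinAt (hF : IsStronglyConvexMinkowskiNormC3 F)
    (hu : IsNeumannEigenfunction F Ω lam u) (hop : IsOpen Ω) (hne : Ω.Nonempty)
    (hconv : Convex ℝ Ω) {x : EuclideanSpace ℝ (Fin n)} (hx : x ∈ closure Ω) :
    HasGradientWithinAt u (gradient u x) (closure Ω) x := by
  have h := (hu.contDiff1.differentiableOn one_ne_zero x hx).hasFDerivWithinAt
  rw [hu.fderivWithin_eq hF hop hne hconv hx] at h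
  rw [hasGradientWithinAt_iff_hasFDerivWithinAt, toDual_gradient]
  exact h

/-- Where the gradient does not vanish, up to the boundary, the second derivatives have limits
which satisfy the equation. -/
lemma exists_secondOrderLimit (hF : IsStronglyConvexMinkowskiNormC3 F)
    (hu : IsNeumannEigenfunction F Ω lam u) (hop : IsOpen Ω) (hne : Ω.Nonempty)
    (hconv : Convex ℝ Ω) {x : EuclideanSpace ℝ (Fin n)} (hx : x ∈ closure Ω)
    (hgx : gradient u x ≠ 0) :
    ∃ B, HasSecondOrderLimit u Ω x B ∧
      ∑ i, ∑ j, aCoeff F i j (gradient u x)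
        * B (EuclideanSpace.single j 1) (EuclideanSpace.single i 1) = -lam * u x := by
  have hgc := hu.continuousOn_gradient hF hop hne hconv
  set S := {x ∈ closure Ω | gradient u x ≠ 0} with hS
  obtain ⟨O, hO, hOS⟩ := continuousOn_iff'.1 hgc {0}ᶜ isOpen_compl_singleton
  have hSO : S = closure Ω ∩ O := by
    rw [inter_comm, ← hOS]
    ext p
    simp [hS, and_comm]
  have hudS : UniqueDiffOn ℝ S := by
    rw [hSO]
    exact (uniqueDiffOn_closure_of_convex hop hne hconv).inter hO
  have hxS : x ∈ S := ⟨hx, hgx⟩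
  have hxO : x ∈ O := (hSO ▸ hxS).2
  have hopen : IsOpen (Ω ∩ O) := hop.inter hO
  have hsubS : Ω ∩ O ⊆ S := by
    rw [hSO]
    exact inter_subset_inter_left _ subset_closure
  have hSnhds : ∀ p ∈ Ω ∩ O, S ∈ 𝓝 p := fun p hp => mem_of_superset (hopen.mem_nhds hp) hsubS
  have hev : ∀ᶠ p in 𝓝[Ω] x, p ∈ Ω ∩ O := by
    filter_upwards [self_mem_nhdsWithin, nhdsWithin_le_nhds (hO.mem_nhds hxO)] with p h1 h2
    exact ⟨h1, h2⟩
  have hle : 𝓝[Ω] x ≤ 𝓝[S] x := by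
    refine le_inf nhdsWithin_le_nhds (le_principal_iff.2 ?_)
    filter_upwards [hev] with p hp using hsubS hp
  have : (𝓝[Ω] x).NeBot := mem_closure_iff_nhdsWithin_neBot.1 hx
  have hc1 : ContDiffOn ℝ 1 (fderivWithin ℝ u S) S := hu.contDiff2.fderivWithin hudS (by norm_num)
  have hc2 : ContinuousOn (fderivWithin ℝ (fderivWithin ℝ u S) S) S :=
    hc1.continuousOn_fderivWithin hudS le_rfl
  have hfd : ∀ p ∈ Ω ∩ O, fderivWithin ℝ u S =ᶠ[𝓝 p] fderiv ℝ u := fun p hp => by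
    filter_upwards [hopen.mem_nhds hp] with q hq
    exact fderivWithin_of_mem_nhds (hSnhds q hq)
  have hlim2 : Tendsto (fderiv ℝ (fderiv ℝ u)) (𝓝[Ω] x)
      (𝓝 (fderivWithin ℝ (fderivWithin ℝ u S) S x)) := by
    refine ((hc2 x hxS).mono_left hle).congr' ?_
    filter_upwards [hev] with p hp
    rw [fderivWithin_of_mem_nhds (hSnhds p hp), (hfd p hp).fderiv_eq]
  have hlim : HasSecondOrderLimit u Ω x (fderivWithin ℝ (fderivWithin ℝ u S) S x) := by
    refine ⟨(hu.contDiff1.continuousOn x hx).mono_left (nhdsWithin_mono x subset_closure),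
      (hu.continuousOn_fderiv hF hop hne hconv x hx).mono_left
        (nhdsWithin_mono x subset_closure), hlim2, ?_⟩
    filter_upwards [hev] with p hp
    refine ⟨(hu.contDiff2.contDiffAt (hSnhds p hp)).differentiableAt (by norm_num), ?_⟩
    exact ((hc1.contDiffAt (hSnhds p hp)).differentiableAt (by norm_num)).congr_of_eventuallyEq
      (hfd p hp).symm
  refine ⟨_, hlim, ?_⟩
  have hgl : Tendsto (gradient u) (𝓝[Ω] x) (𝓝 (gradient u x)) :=
    (hgc x hx).mono_left (nhdsWithin_mono x subset_closure)
  have l1 : Tendsto (fun p => ∑ i, ∑ j, aCoeff F i j (gradient u p)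
      * fderiv ℝ (fderiv ℝ u) p (EuclideanSpace.single j 1) (EuclideanSpace.single i 1))
      (𝓝[Ω] x) (𝓝 (∑ i, ∑ j, aCoeff F i j (gradient u x)
        * fderivWithin ℝ (fderivWithin ℝ u S) S x
          (EuclideanSpace.single j 1) (EuclideanSpace.single i 1))) := by
    refine tendsto_finsetSum _ fun i _ => tendsto_finsetSum _ fun j _ => ?_
    exact ((hF.continuousAt_aCoeff hgx i j).tendsto.comp hgl).mul
      ((Tendsto.continuousLinearMap_apply hlim2 _).continuousLinearMap_apply _)
  refine tendsto_nhds_unique (l1.congr' ?_) (hlim.tendsto.const_mul (-lam))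
  filter_upwards [hev, hlim.differentiableAt] with p hp hd
  rw [← hu.eqn p hp.1 (hsubS hp).2]
  simp_rw [pd_pd_eq hd.2]

end IsNeumannEigenfunction

end Regularity

section TwoPoint

variable {n : ℕ} {F u : EuclideanSpace ℝ (Fin n) → ℝ} {Ω : Set (EuclideanSpace ℝ (Fin n))}
  {lam σ L : ℝ} {x y : EuclideanSpace ℝ (Fin n)}
  {B : EuclideanSpace ℝ (Fin n) →L[ℝ] EuclideanSpace ℝ (Fin n) →L[ℝ] ℝ}

/-- The second derivative of `arcsin (u / σ)` at `x`, where `B` is that of `u`. -/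
def arcsinHessian (σ : ℝ) (u : EuclideanSpace ℝ (Fin n) → ℝ) (x : EuclideanSpace ℝ (Fin n))
    (B : EuclideanSpace ℝ (Fin n) →L[ℝ] EuclideanSpace ℝ (Fin n) →L[ℝ] ℝ) :
    EuclideanSpace ℝ (Fin n) →L[ℝ] EuclideanSpace ℝ (Fin n) →L[ℝ] ℝ :=
  arcsinSlope σ (u x) • B
    + (u x * arcsinSlope σ (u x) ^ 3) • (fderiv ℝ u x).smulRight (fderiv ℝ u x)

lemma arcsinHessian_apply (v w : EuclideanSpace ℝ (Fin n)) :
    arcsinHessian σ u x B v w = arcsinSlope σ (u x) * B v w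
      + u x * arcsinSlope σ (u x) ^ 3 * (fderiv ℝ u x v * fderiv ℝ u x w) := by
  simp [arcsinHessian]

lemma trace_arcsinHessian (hF : IsStronglyConvexMinkowskiNormC3 F) (hσ : |u x| < σ)
    (hgx : gradient u x ≠ 0)
    (hB : ∑ i, ∑ j, aCoeff F i j (gradient u x)
      * B (EuclideanSpace.single j 1) (EuclideanSpace.single i 1) = -lam * u x) :
    ∑ i, ∑ j, aCoeff F i j (arcsinSlope σ (u x) • gradient u x) * arcsinHessian σ u x B
        (EuclideanSpace.single j 1) (EuclideanSpace.single i 1)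
      = (F (arcsinSlope σ (u x) • gradient u x) ^ 2 - lam) * (arcsinSlope σ (u x) * u x) := by
  have hk := arcsinSlope_pos hσ
  have hD : ∀ i, fderiv ℝ u x (EuclideanSpace.single i 1) = gradient u x i := fun i => by
    rw [← inner_gradient_eq, EuclideanSpace.inner_single_right]
    simp
  have h1 : ∀ i j, aCoeff F i j (arcsinSlope σ (u x) • gradient u x) * arcsinHessian σ u x B
        (EuclideanSpace.single j 1) (EuclideanSpace.single i 1)
      = arcsinSlope σ (u x) * (aCoeff F i j (gradient u x)
          * B (EuclideanSpace.single j 1) (EuclideanSpace.single i 1))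
        + u x * arcsinSlope σ (u x) ^ 3
          * (aCoeff F i j (gradient u x) * gradient u x i * gradient u x j) := fun i j => by
    rw [hF.aCoeff_smul hk.ne' i j hgx, arcsinHessian_apply, hD, hD]
    ring
  simp_rw [h1, Finset.sum_add_distrib, ← Finset.mul_sum]
  rw [hB, hF.sum_aCoeff_self hgx, hF.homog, abs_of_pos hk]
  ring

lemma HasGradientWithinAt.arcsin_div {C : Set (EuclideanSpace ℝ (Fin n))}
    {g : EuclideanSpace ℝ (Fin n)} (hu : HasGradientWithinAt u g C x) (hσ : |u x| < σ) :
    HasGradientWithinAt (fun p => arcsin (u p / σ)) (arcsinSlope σ (u x) • g) C x := by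
  rw [hasGradientWithinAt_iff_hasFDerivWithinAt] at hu ⊢
  rw [map_smul]
  exact (hasDerivAt_arcsin_div hσ).comp_hasFDerivWithinAt x hu

namespace IsNeumannEigenfunction

lemma inner_gradient_normal (hu : IsNeumannEigenfunction F Ω lam u) (hop : IsOpen Ω)
    (hx : x ∈ closure Ω) (hgx : gradient u x ≠ 0) {ν : EuclideanSpace ℝ (Fin n)}
    (hν : ∀ p ∈ closure Ω, ⟪ν, p - x⟫ ≤ 0) : ⟪gradient F (gradient u x), ν⟫ = 0 := by
  rcases eq_or_ne ν 0 with rfl | hν0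
  · exact inner_zero_right _
  by_cases hxΩ : x ∈ Ω
  · obtain ⟨t, ht, htΩ⟩ := ((eventually_mem_nhdsWithin (s := Ioi (0 : ℝ))).and
      (eventually_mem_of_mem hop hxΩ ν)).exists
    have h := hν _ (subset_closure htΩ)
    rw [add_sub_cancel_left, real_inner_smul_right] at h
    exact absurd h (mul_pos ht (real_inner_self_pos.2 hν0)).not_ge
  · exact hu.neumann x (by rw [hop.frontier_eq]; exact ⟨hx, hxΩ⟩) hgx ν hν0 hν

/-- The second-order condition at a maximum of `arcsin (u y / σ) - arcsin (u x / σ)` under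
simultaneous translations of `x` and `y`. -/
lemma second_order (hF : IsStronglyConvexMinkowskiNormC3 F)
    (hu : IsNeumannEigenfunction F Ω lam u) (hop : IsOpen Ω) (hne : Ω.Nonempty)
    (hconv : Convex ℝ Ω) (hσ : ∀ p ∈ closure Ω, |u p| < σ)
    (hx : x ∈ closure Ω) (hy : y ∈ closure Ω) (hgx : gradient u x ≠ 0) (hgy : gradient u y ≠ 0)
    (hg : arcsinSlope σ (u y) • gradient u y = arcsinSlope σ (u x) • gradient u x)
    {ν : EuclideanSpace ℝ (Fin n)} (hν : ν ≠ 0)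
    (hfeas : ∀ v, ⟪ν, v⟫ < 0 →
      (∀ᶠ t : ℝ in 𝓝[>] 0, x + t • v ∈ Ω) ∧ ∀ᶠ t : ℝ in 𝓝[>] 0, y + t • v ∈ Ω)
    (hmax : ∀ v, x + v ∈ closure Ω → y + v ∈ closure Ω →
      arcsin (u (y + v) / σ) - arcsin (u (x + v) / σ) ≤ arcsin (u y / σ) - arcsin (u x / σ)) :
    (F (arcsinSlope σ (u y) • gradient u y) ^ 2 - lam)
      * (arcsinSlope σ (u y) * u y - arcsinSlope σ (u x) * u x) ≤ 0 := by
  obtain ⟨Bx, hBx, hex⟩ := hu.exists_secondOrderLimit hF hop hne hconv hx hgx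
  obtain ⟨By, hBy, hey⟩ := hu.exists_secondOrderLimit hF hop hne hconv hy hgy
  have hσΩ : ∀ p ∈ Ω, |u p| < σ := fun p hp => hσ p (subset_closure hp)
  have hslope : ∀ v, arcsinSlope σ (u y) * fderiv ℝ u y v
      = arcsinSlope σ (u x) * fderiv ℝ u x v := fun v => by
    rw [← inner_gradient_eq, ← inner_gradient_eq, ← real_inner_smul_left, hg,
      real_inner_smul_left]
  have hquad : ∀ v, (arcsinHessian σ u y By - arcsinHessian σ u x Bx) v v ≤ 0 := by
    refine bilin_nonpos_of_halfspace hν _ fun v hv => ?_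
    obtain ⟨hvx, hvy⟩ := hfeas v hv
    obtain ⟨a₁, a₂, a1, a2, al0, al1, al2⟩ := hBx.arcsin_path hσΩ (hσ x hx) hvx
    obtain ⟨b₁, b₂, b1, b2, bl0, bl1, bl2⟩ := hBy.arcsin_path hσΩ (hσ y hy) hvy
    have hl1 := bl1.sub al1
    rw [hslope, sub_self] at hl1
    have h := second_deriv_nonpos_of_one_sided_max
      (g := fun t : ℝ => arcsin (u (y + t • v) / σ) - arcsin (u (x + t • v) / σ))
      (by filter_upwards [a1, b1] with t h1 h2 using h2.sub h1)
      (by filter_upwards [a2, b2] with t h1 h2 using h2.sub h1)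
      (bl0.sub al0) hl1 (bl2.sub al2)
      (by filter_upwards [hvx, hvy] with t h1 h2 using
        hmax _ (subset_closure h1) (subset_closure h2))
    simp only [_root_.sub_apply, arcsinHessian_apply]
    linarith
  have hξ : arcsinSlope σ (u y) • gradient u y ≠ 0 :=
    smul_ne_zero (arcsinSlope_pos (hσ y hy)).ne' hgy
  have htr := sum_mul_bilin_nonpos (fun i j => aCoeff F i j (arcsinSlope σ (u y) • gradient u y))
    (hF.aCoeff_symm hξ) (hF.sum_aCoeff_nonneg hξ) _ hquad
  simp only [_root_.sub_apply, mul_sub, Finset.sum_sub_distrib] at htr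
  rw [trace_arcsinHessian hF (hσ y hy) hgy hey] at htr
  simp only [hg] at htr
  rw [trace_arcsinHessian hF (hσ x hx) hgx hex] at htr
  rw [hg]
  linarith

/-- The anisotropic Lipschitz bound for `arcsin (u / σ)`. -/
lemma arcsin_sub_le (hF : IsStronglyConvexMinkowskiNormC3 F)
    (hu : IsNeumannEigenfunction F Ω lam u) (hbd : Bornology.IsBounded Ω) (hop : IsOpen Ω)
    (hne : Ω.Nonempty) (hconv : Convex ℝ Ω) (hsb : HasSmoothBoundary Ω)
    (hσ : ∀ p ∈ closure Ω, |u p| < σ) (hL : 0 < L) (hlamL : lam < L ^ 2)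
    (hx : x ∈ closure Ω) (hy : y ∈ closure Ω) :
    arcsin (u y / σ) - arcsin (u x / σ) ≤ L * dualNorm F (y - x) := by
  set w := fun p => arcsin (u p / σ) with hw
  have hK : IsCompact (closure Ω ×ˢ closure Ω) := hbd.isCompact_closure.prod hbd.isCompact_closure
  have hwc : ContinuousOn w (closure Ω) :=
    continuous_arcsin.comp_continuousOn (hu.contDiff1.continuousOn.div_const σ)
  have hZ : ContinuousOn (fun q : EuclideanSpace ℝ (Fin n) × EuclideanSpace ℝ (Fin n) =>
      w q.2 - w q.1 - L * dualNorm F (q.2 - q.1)) (closure Ω ×ˢ closure Ω) := by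
    have h1 : ContinuousOn (fun q : EuclideanSpace ℝ (Fin n) × EuclideanSpace ℝ (Fin n) => w q.1)
        (closure Ω ×ˢ closure Ω) := hwc.comp continuousOn_fst fun q hq => hq.1
    have h2 : ContinuousOn (fun q : EuclideanSpace ℝ (Fin n) × EuclideanSpace ℝ (Fin n) => w q.2)
        (closure Ω ×ˢ closure Ω) := hwc.comp continuousOn_snd fun q hq => hq.2
    have h3 : Continuous fun q : EuclideanSpace ℝ (Fin n) × EuclideanSpace ℝ (Fin n) =>
        L * dualNorm F (q.2 - q.1) :=
      continuous_const.mul (hF.continuous_dualNorm.comp (continuous_snd.sub continuous_fst))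
    exact (h2.sub h1).sub h3.continuousOn
  obtain ⟨⟨a, b⟩, ⟨ha, hb⟩, hab⟩ := hK.exists_isMaxOn ⟨(x, y), hx, hy⟩ hZ
  have hmax : ∀ p ∈ closure Ω, ∀ q ∈ closure Ω,
      w q - w p - L * dualNorm F (q - p) ≤ w b - w a - L * dualNorm F (b - a) :=
    fun p hp q hq => isMaxOn_iff.1 hab (p, q) ⟨hp, hq⟩
  suffices hle : w b - w a - L * dualNorm F (b - a) ≤ 0 by
    have := hmax x hx y hy
    linarith
  by_contra! hpos
  have hwab : w a < w b := by
    have := mul_nonneg hL.le (hF.dualNorm_nonneg (b - a))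
    linarith
  have hba : b - a ≠ 0 := fun h => by
    rw [sub_eq_zero.1 h] at hwab
    exact hwab.false
  have hab0 : a - b ≠ 0 := fun h => hba (by rw [← neg_sub, h, neg_zero])
  have hka := arcsinSlope_pos (hσ a ha)
  have hkb := arcsinSlope_pos (hσ b hb)
  have hCconv := hconv.closure
  obtain ⟨hξb, hFb, hdb⟩ := hF.first_order hCconv ha hb hba hL
    ((hu.hasGradientWithinAt hF hop hne hconv hb).arcsin_div (hσ b hb))
    (fun p hp => by have := hmax a ha p hp; simp only [hw] at this; linarith)
    (fun h ν hν => by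
      rw [hF.gradient_smul hkb]
      exact hu.inner_gradient_normal hop hb (right_ne_zero_of_smul h) hν)
  obtain ⟨hξa, hFa, hda⟩ := hF.first_order hCconv hb ha hab0 hL
    (w := fun p => -w p) (ξ := -(arcsinSlope σ (u a) • gradient u a))
    (by
      have := (hu.hasGradientWithinAt hF hop hne hconv ha).arcsin_div (hσ a ha)
      rw [hasGradientWithinAt_iff_hasFDerivWithinAt] at this ⊢
      rw [map_neg]
      exact this.neg)
    (fun p hp => by
      have := hmax p hp b hb
      rw [← neg_sub b p, hF.dualNorm_neg, ← neg_sub b a, hF.dualNorm_neg]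
      linarith)
    (fun h ν hν => by
      rw [hF.gradient_neg, hF.gradient_smul hka, inner_neg_left,
        hu.inner_gradient_normal hop ha (right_ne_zero_of_smul (neg_ne_zero.1 h)) hν, neg_zero])
  rw [neg_ne_zero] at hξa
  rw [hF.even] at hFa
  rw [hF.gradient_neg, ← neg_sub b a, hF.dualNorm_neg, smul_neg, neg_inj] at hda
  have hgradF : gradient F (arcsinSlope σ (u b) • gradient u b)
      = gradient F (arcsinSlope σ (u a) • gradient u a) :=
    smul_right_injective _ (hF.dualNorm_pos hba).ne' (hdb.symm.trans hda)
  have hgrad : arcsinSlope σ (u b) • gradient u b = arcsinSlope σ (u a) • gradient u a :=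
    hF.eq_of_gradient_eq hξb hξa (hFb.trans hFa.symm) hgradF
  have hga := right_ne_zero_of_smul hξa
  have hgb := right_ne_zero_of_smul hξb
  obtain ⟨ν, hν, hfeas⟩ := exists_common_halfspace hop hconv hsb ha hb hba
    (fun ν hν => by
      rw [hda, hF.gradient_smul hka, real_inner_smul_right, real_inner_comm,
        hu.inner_gradient_normal hop ha hga hν, mul_zero])
    (fun ν hν => by
      rw [hdb, hF.gradient_smul hkb, real_inner_smul_right, real_inner_comm,
        hu.inner_gradient_normal hop hb hgb hν, mul_zero])
  have h2 := hu.second_order hF hop hne hconv hσ ha hb hga hgb hgrad hν hfeas fun v hav hbv => by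
    have := hmax _ hav _ hbv
    rw [add_sub_add_right_eq_sub] at this
    simp only [hw] at this
    linarith
  rw [hFb] at h2
  have hσ0 : 0 < σ := (abs_nonneg _).trans_lt (hσ a ha)
  have huab : u a < u b := by
    by_contra! h
    exact hwab.not_ge (monotone_arcsin (div_le_div_of_nonneg_right h hσ0.le))
  have := strictMonoOn_arcsinSlope_mul (abs_lt.1 (hσ a ha)) (abs_lt.1 (hσ b hb)) huab
  exact h2.not_gt (mul_pos (sub_pos.2 hlamL) (sub_pos.2 this))

lemma sq_gradient_le (hF : IsStronglyConvexMinkowskiNormC3 F)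
    (hu : IsNeumannEigenfunction F Ω lam u) (hbd : Bornology.IsBounded Ω) (hop : IsOpen Ω)
    (hne : Ω.Nonempty) (hconv : Convex ℝ Ω) (hsb : HasSmoothBoundary Ω)
    (hσ : ∀ p ∈ closure Ω, |u p| < σ) (hL : 0 < L) (hlamL : lam < L ^ 2) (hx : x ∈ Ω) :
    F (gradient u x) ^ 2 ≤ L ^ 2 * (σ ^ 2 - u x ^ 2) := by
  have hxC := subset_closure hx
  have hpos := sq_sub_sq_pos_of_abs_lt (hσ x hxC)
  have hk := arcsinSlope_pos (hσ x hxC)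
  rcases eq_or_ne (gradient u x) 0 with h0 | h0
  · rw [h0, hF.map_zero, zero_pow two_ne_zero]
    exact mul_nonneg (sq_nonneg L) hpos.le
  set V := gradient F (gradient u x) with hV
  obtain ⟨s, hs, hsΩ⟩ := ((eventually_mem_nhdsWithin (s := Ioi (0 : ℝ))).and
    (eventually_mem_of_mem hop hx V)).exists
  have hs : 0 < s := hs
  have hsC := subset_closure hsΩ
  have h1 : ⟪arcsinSlope σ (u x) • gradient u x, x + s • V - x⟫ ≤ L * s := by
    refine inner_le_of_segment hconv.closure
      ((hu.hasGradientWithinAt hF hop hne hconv hxC).arcsin_div (hσ x hxC)) hxC hsC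
      fun t ht => ?_
    have h2 := hu.arcsin_sub_le hF hbd hop hne hconv hsb hσ hL hlamL hxC
      (hconv.closure.add_smul_sub_mem hxC hsC ⟨ht.1.le, ht.2⟩)
    have h3 : dualNorm F (x + t • (x + s • V - x) - x) ≤ t * s := by
      rw [add_sub_cancel_left, add_sub_cancel_left, smul_smul]
      have hts : 0 ≤ t * s := mul_nonneg ht.1.le hs.le
      exact (hF.dualNorm_smul_le hts V).trans
        (mul_le_of_le_one_right hts (hF.dualNorm_gradient_le h0))
    have h4 := mul_le_mul_of_nonneg_left h3 hL.le
    linarith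
  rw [add_sub_cancel_left, real_inner_smul_right, real_inner_smul_left, real_inner_comm,
    hF.gradient_inner_self h0, mul_comm L s] at h1
  have h2 := pow_le_pow_left₀ (mul_nonneg hk.le (hF.nonneg _)) (le_of_mul_le_mul_left h1 hs) 2
  rwa [mul_pow, arcsinSlope_sq (hσ x hxC), inv_mul_le_iff₀ hpos, mul_comm] at h2

end IsNeumannEigenfunction

end TwoPoint

/-- Gradient estimate for Neumann eigenfunctions: if `sup |u| ≤ 1` then
`F(∇u)² + λu² ≤ λ` on the closure of `Ω`. -/
theorem neumann_gradient_estimate {n : ℕ} (hn : 1 ≤ n)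
    (Ω : Set (EuclideanSpace ℝ (Fin n))) (hne : Ω.Nonempty)
    (hbd : Bornology.IsBounded Ω) (hop : IsOpen Ω) (hconv : Convex ℝ Ω)
    (hsb : HasSmoothBoundary Ω)
    (F : EuclideanSpace ℝ (Fin n) → ℝ) (hF : IsStronglyConvexMinkowskiNormC3 F)
    (lam : ℝ) (hlam : 0 < lam)
    (u : EuclideanSpace ℝ (Fin n) → ℝ)
    (hu : IsNeumannEigenfunction F Ω lam u)
    (hnc : ¬ ∃ c : ℝ, ∀ x ∈ closure Ω, u x = c)
    (hbound : ∀ x ∈ closure Ω, |u x| ≤ 1) :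
    ∀ x ∈ closure Ω, F (gradient u x) ^ 2 + lam * u x ^ 2 ≤ lam := by
  have hinterior : ∀ x ∈ Ω, F (gradient u x) ^ 2 + lam * u x ^ 2 ≤ lam := by
    intro x hx
    have hlim : Tendsto (fun ε : ℝ => lam * (1 + ε) * (1 + ε - u x ^ 2)) (𝓝[>] 0)
        (𝓝 (lam * (1 + 0) * (1 + 0 - u x ^ 2))) :=
      Continuous.continuousWithinAt (by fun_prop)
    have hle : F (gradient u x) ^ 2 ≤ lam * (1 + 0) * (1 + 0 - u x ^ 2) := by
      refine ge_of_tendsto hlim ?_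
      filter_upwards [self_mem_nhdsWithin] with ε hε
      have hε : 0 < ε := hε
      have hσ : ∀ p ∈ closure Ω, |u p| < √(1 + ε) := fun p hp =>
        (hbound p hp).trans_lt (Real.lt_sqrt_of_sq_lt (by linarith))
      have hLsq : √(lam * (1 + ε)) ^ 2 = lam * (1 + ε) := Real.sq_sqrt (by positivity)
      have h := hu.sq_gradient_le hF hbd hop hne hconv hsb hσ
        (Real.sqrt_pos.2 (by positivity : 0 < lam * (1 + ε)))
        (by rw [hLsq]; exact lt_mul_of_one_lt_right hlam (by linarith)) hx
      rwa [hLsq, Real.sq_sqrt (by positivity)] at h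
    linarith
  have hcont : ContinuousOn (fun x => F (gradient u x) ^ 2 + lam * u x ^ 2) (closure Ω) :=
    ((hF.continuous.comp_continuousOn
      (hu.continuousOn_gradient hF hop hne hconv)).pow 2).add
      (continuousOn_const.mul (hu.contDiff1.continuousOn.pow 2))
  intro x hx
  have : (𝓝[Ω] x).NeBot := mem_closure_iff_nhdsWithin_neBot.1 hx
  exact le_of_tendsto ((hcont x hx).mono_left (nhdsWithin_mono x subset_closure))
    (eventually_mem_nhdsWithin.mono hinterior)
end
end

section
/- (Rigidity of the gradient direction) Let n ≥ 1, let F be a strongly convex Minkowski norm of class C³ on ℝⁿ∖{0}, let λ > 0, and let U ⊆ ℝⁿ be a connected open set. Let u be a C² function on U with ∇u(x) ≠ 0 for all x ∈ U, satisfying Σ_{i,j} a_{ij}(∇u(x)) u_{ij}(x) = −λ u(x) and F(∇u(x))² + λ u(x)² = λ for all x ∈ U. Then the Hessian of u satisfies u_{ij} = −λ u u_i u_j / F(∇u)² on U (i.e. D²u = −λ u X* ⊗ X* where X = ∇u/F(∇u)), and the vector field X = ∇u/F(∇u) is constant on U. -/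
open Real
open scoped RealInnerProductSpace

noncomputable section

section Geodesic

variable {E : Type*} [NormedAddCommGroup E] [NormedSpace ℝ E]

/-- A `C¹` vector field that is parallel along itself is constant along its straight flow lines,
locally uniformly in the base point. -/
lemma exists_forall_apply_add_smul_self_eq {Z : E → E} {U : Set E} (hU : IsOpen U)
    (hZ : ContDiffOn ℝ 1 Z U) (hgeo : ∀ x ∈ U, fderiv ℝ Z x (Z x) = 0) {x₀ : E} (hx₀ : x₀ ∈ U) :
    ∃ δ > 0, ∀ᶠ x in nhds x₀, ∀ t ∈ Set.Icc (0 : ℝ) δ,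
      x + t • Z x ∈ U ∧ Z (x + t • Z x) = Z x := by
  have hcd : ContinuousOn (fderiv ℝ Z) U := hZ.continuousOn_fderiv_of_isOpen hU le_rfl
  have hUn := hU.mem_nhds hx₀
  have h1 := (hcd.continuousAt hUn).norm.eventually_lt_const (lt_add_one ‖fderiv ℝ Z x₀‖)
  have h2 := (hZ.continuousOn.continuousAt hUn).norm.eventually_lt_const (lt_add_one ‖Z x₀‖)
  set K := ‖fderiv ℝ Z x₀‖ + 1
  set M := ‖Z x₀‖ + 1
  have hMpos : 0 < M := by positivity
  obtain ⟨ρ, hρ, hball⟩ := Metric.eventually_nhds_iff_ball.1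
    ((show ∀ᶠ y in nhds x₀, y ∈ U from hUn).and (h1.and h2))
  refine ⟨ρ / 2 / M, by positivity, ?_⟩
  filter_upwards [Metric.ball_mem_nhds x₀ (half_pos hρ)] with x hx
  have hxρ := hball x (Metric.ball_subset_ball (by linarith) hx)
  have hmem : ∀ t ∈ Set.Icc (0 : ℝ) (ρ / 2 / M), x + t • Z x ∈ Metric.ball x₀ ρ := by
    rintro t ⟨ht0, ht1⟩
    have : t * ‖Z x‖ ≤ ρ / 2 := by
      rw [le_div_iff₀ hMpos] at ht1
      exact (mul_le_mul_of_nonneg_left hxρ.2.2.le ht0).trans ht1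
    rw [mem_ball_iff_norm] at hx ⊢
    calc ‖x + t • Z x - x₀‖ = ‖(x - x₀) + t • Z x‖ := by congr 1; abel
      _ ≤ ‖x - x₀‖ + ‖t • Z x‖ := norm_add_le _ _
      _ < ρ := by rw [norm_smul, Real.norm_of_nonneg ht0]; linarith
  have hderiv : ∀ t ∈ Set.Icc (0 : ℝ) (ρ / 2 / M),
      HasDerivAt (fun t : ℝ => Z (x + t • Z x) - Z x) (fderiv ℝ Z (x + t • Z x) (Z x)) t := by
    intro t ht
    have hZd := ((hZ.differentiableOn one_ne_zero).differentiableAt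
      (hU.mem_nhds (hball _ (hmem t ht)).1)).hasFDerivAt
    have hline : HasDerivAt (fun t : ℝ => x + t • Z x) (Z x) t := by
      simpa using ((hasDerivAt_id t).smul_const (Z x)).const_add x
    exact (hZd.comp_hasDerivAt t hline).sub_const _
  have hzero := eq_zero_of_abs_deriv_le_mul_abs_self_of_eq_zero_right (K := K)
    (fun t ht => (hderiv t ht).continuousAt.continuousWithinAt)
    (fun t ht => (hderiv t (Set.Ico_subset_Icc_self ht)).hasDerivWithinAt) (by simp) (by
      intro t ht
      have hb := hball _ (hmem t (Set.Ico_subset_Icc_self ht))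
      have hself := hgeo _ hb.1
      calc ‖fderiv ℝ Z (x + t • Z x) (Z x)‖
          = ‖fderiv ℝ Z (x + t • Z x) (Z (x + t • Z x) - Z x)‖ := by
            rw [map_sub, hself, zero_sub, norm_neg]
        _ ≤ K * ‖Z (x + t • Z x) - Z x‖ :=
            ContinuousLinearMap.le_of_opNorm_le _ hb.2.1.le _)
  exact fun t ht => ⟨(hball _ (hmem t ht)).1, sub_eq_zero.1 (hzero t ht)⟩

/-- A divergence-free `C¹` vector field that is parallel along itself has a Jacobian whose square
is trace-free. -/
lemma trace_fderiv_comp_fderiv_eq_zero [FiniteDimensional ℝ E] {Z : E → E} {U : Set E}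
    (hU : IsOpen U) (hZ : ContDiffOn ℝ 1 Z U) (hgeo : ∀ x ∈ U, fderiv ℝ Z x (Z x) = 0)
    (hdiv : ∀ x ∈ U, LinearMap.trace ℝ E (fderiv ℝ Z x : E →ₗ[ℝ] E) = 0) {x₀ : E} (hx₀ : x₀ ∈ U) :
    LinearMap.trace ℝ E ((fderiv ℝ Z x₀ : E →ₗ[ℝ] E) ∘ₗ (fderiv ℝ Z x₀ : E →ₗ[ℝ] E)) = 0 := by
  obtain ⟨δ, hδ, hflow⟩ := exists_forall_apply_add_smul_self_eq hU hZ hgeo hx₀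
  have hdiff : ∀ x ∈ U, HasFDerivAt Z (fderiv ℝ Z x) x := fun x hx =>
    ((hZ.differentiableOn one_ne_zero).differentiableAt (hU.mem_nhds hx)).hasFDerivAt
  have hcd : ContinuousOn (fderiv ℝ Z) U := hZ.continuousOn_fderiv_of_isOpen hU le_rfl
  set P := fderiv ℝ Z x₀
  let T : (E →L[ℝ] E) →ₗ[ℝ] ℝ :=
    LinearMap.trace ℝ E ∘ₗ LinearMap.lcomp ℝ E (P : E →ₗ[ℝ] E) ∘ₗ ContinuousLinearMap.coeLM ℝ
  have hTc : Continuous T := T.continuous_of_finiteDimensional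
  have hvanish : ∀ t ∈ Set.Ioc (0 : ℝ) δ, T (fderiv ℝ Z (x₀ + t • Z x₀)) = 0 := by
    intro t ht
    have ht' := Set.Ioc_subset_Icc_self ht
    have hyU := (hflow.self_of_nhds t ht').1
    have hline : HasFDerivAt (fun x => x + t • Z x) (ContinuousLinearMap.id ℝ E + t • P) x₀ :=
      (hasFDerivAt_id x₀).add ((hdiff x₀ hx₀).const_smul t)
    have hcomp := (hdiff _ hyU).comp (f := fun x => x + t • Z x) x₀ hline
    have heq := (hcomp.congr_of_eventuallyEq (hflow.mono fun x hx => (hx t ht').2.symm)).unique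
      (hdiff x₀ hx₀)
    have hlin : (fderiv ℝ Z (x₀ + t • Z x₀) : E →ₗ[ℝ] E) +
        t • ((fderiv ℝ Z (x₀ + t • Z x₀) : E →ₗ[ℝ] E) ∘ₗ (P : E →ₗ[ℝ] E)) = (P : E →ₗ[ℝ] E) := by
      ext v
      simpa using congrArg (fun L : E →L[ℝ] E => L v) heq
    have htr := congrArg (LinearMap.trace ℝ E) hlin
    rw [map_add, map_smul, hdiv _ hyU, hdiv _ hx₀, zero_add, smul_eq_mul] at htr
    exact (mul_eq_zero.1 htr).resolve_left ht.1.ne'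
  have hlim : Filter.Tendsto (fun t : ℝ => T (fderiv ℝ Z (x₀ + t • Z x₀)))
      (nhdsWithin 0 (Set.Ioi 0)) (nhds (T P)) := by
    refine Filter.Tendsto.mono_left ?_ nhdsWithin_le_nhds
    have hcP : ContinuousAt (fderiv ℝ Z) (x₀ + (0 : ℝ) • Z x₀) := by
      simpa using hcd.continuousAt (hU.mem_nhds hx₀)
    have hl : ContinuousAt (fun t : ℝ => x₀ + t • Z x₀) 0 := by fun_prop
    have := hTc.continuousAt.comp (hcP.comp (f := fun t : ℝ => x₀ + t • Z x₀) hl)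
    simpa [ContinuousAt, Function.comp_def] using this
  have hev : (fun t : ℝ => T (fderiv ℝ Z (x₀ + t • Z x₀))) =ᶠ[nhdsWithin 0 (Set.Ioi 0)]
      fun _ => (0 : ℝ) := by
    filter_upwards [Ioc_mem_nhdsGT hδ] with t ht using hvanish t ht
  exact tendsto_nhds_unique (hlim.congr' hev) tendsto_const_nhds

end Geodesic

section InnerProduct

variable {E : Type*} [NormedAddCommGroup E] [InnerProductSpace ℝ E] [FiniteDimensional ℝ E]

lemma LinearMap.IsSymmetric.eq_zero_of_trace_sq_comp_eq_zero {A B : E →ₗ[ℝ] E}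
    (hA : A.IsSymmetric) (hpos : ∀ v, v ≠ 0 → 0 < ⟪v, A v⟫) (hB : B.IsSymmetric)
    (htr : LinearMap.trace ℝ E ((A ∘ₗ B) ∘ₗ (A ∘ₗ B)) = 0) : B = 0 := by
  have hnonneg : ∀ v, 0 ≤ ⟪v, A v⟫ := fun v => by
    rcases eq_or_ne v 0 with rfl | hv
    · simp
    · exact (hpos v hv).le
  let b := hA.eigenvectorBasis rfl
  have hb : ∀ i, A (b i) = hA.eigenvalues rfl i • b i := hA.apply_eigenvectorBasis rfl
  have hμ : ∀ i, 0 < hA.eigenvalues rfl i := fun i => by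
    have h := hpos (b i) (b.orthonormal.ne_zero i)
    rwa [hb, real_inner_smul_right, real_inner_self_eq_norm_sq, b.norm_eq_one, one_pow,
      mul_one] at h
  have hterm : ∀ i, ⟪b i, ((A ∘ₗ B) ∘ₗ (A ∘ₗ B)) (b i)⟫ =
      hA.eigenvalues rfl i * ⟪B (b i), A (B (b i))⟫ := fun i => by
    simp only [LinearMap.comp_apply]
    rw [← hA, hb, real_inner_smul_left, ← hB]
  rw [LinearMap.trace_eq_sum_inner _ b, Finset.sum_eq_zero_iff_of_nonneg
    fun i _ => by rw [hterm]; exact mul_nonneg (hμ i).le (hnonneg _)] at htr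
  refine b.toBasis.ext fun i => ?_
  by_contra hne
  have h := htr i (Finset.mem_univ i)
  rw [hterm] at h
  exact (mul_pos (hμ i) (hpos _ (by simpa using hne))).ne' h

end InnerProduct

section Gradient

variable {E : Type*} [NormedAddCommGroup E] [InnerProductSpace ℝ E] [CompleteSpace E]

lemma ContDiffOn.gradient_of_isOpen {f : E → ℝ} {s : Set E} {m k : WithTop ℕ∞}
    (hf : ContDiffOn ℝ k f s) (hs : IsOpen s) (hmk : m + 1 ≤ k) :
    ContDiffOn ℝ m (gradient f) s :=
  (InnerProductSpace.toDual ℝ E).symm.contDiff.comp_contDiffOn (hf.fderiv_of_isOpen hs hmk)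

lemma inner_fderiv_gradient {f : E → ℝ} {x : E} (hf : ContDiffAt ℝ 2 f x) (v w : E) :
    ⟪fderiv ℝ (gradient f) x v, w⟫ = fderiv ℝ (fderiv ℝ f) x v w := by
  have h1 : DifferentiableAt ℝ (fderiv ℝ f) x :=
    (hf.fderiv_right (m := 1) le_rfl).differentiableAt one_ne_zero
  have h2 : HasFDerivAt (gradient f) _ x :=
    ((InnerProductSpace.toDual ℝ E).symm.toContinuousLinearEquiv.hasFDerivAt).comp x h1.hasFDerivAt
  rw [h2.fderiv]
  exact InnerProductSpace.toDual_symm_apply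

lemma isSymmetric_fderiv_gradient {f : E → ℝ} {x : E} (hf : ContDiffAt ℝ 2 f x) :
    (fderiv ℝ (gradient f) x : E →ₗ[ℝ] E).IsSymmetric := fun v w => by
  change ⟪fderiv ℝ (gradient f) x v, w⟫ = ⟪v, fderiv ℝ (gradient f) x w⟫
  rw [real_inner_comm _ v, inner_fderiv_gradient hf, inner_fderiv_gradient hf]
  exact (hf.isSymmSndFDerivAt (by simp)).eq v w

end Gradient

section Coordinates

variable {n : ℕ}

lemma gradient_apply_eq_pd (f : EuclideanSpace ℝ (Fin n) → ℝ) (x : EuclideanSpace ℝ (Fin n))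
    (i : Fin n) : gradient f x i = pd f i x := by
  rw [pd, ← inner_gradient_left, EuclideanSpace.inner_single_right]
  simp

lemma pd_pd_eq_fderiv_gradient {f : EuclideanSpace ℝ (Fin n) → ℝ} {x : EuclideanSpace ℝ (Fin n)}
    (hf : ContDiffAt ℝ 2 f x) (i j : Fin n) :
    pd (pd f i) j x = fderiv ℝ (gradient f) x (EuclideanSpace.single j 1) i := by
  have h1 : DifferentiableAt ℝ (fderiv ℝ f) x :=
    (hf.fderiv_right (m := 1) le_rfl).differentiableAt one_ne_zero
  have h2 : fderiv ℝ (gradient f) x (EuclideanSpace.single j 1) i =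
      ⟪fderiv ℝ (gradient f) x (EuclideanSpace.single j 1), EuclideanSpace.single i 1⟫ := by
    rw [EuclideanSpace.inner_single_right]; simp
  rw [h2, inner_fderiv_gradient hf]
  change fderiv ℝ (fun y => fderiv ℝ f y (EuclideanSpace.single i 1)) x _ = _
  rw [fderiv_clm_apply h1 (differentiableAt_const _)]
  simp

lemma trace_comp_eq_sum_apply_single {A B : EuclideanSpace ℝ (Fin n) →ₗ[ℝ] EuclideanSpace ℝ (Fin n)}
    (hA : A.IsSymmetric) :
    LinearMap.trace ℝ _ (A ∘ₗ B) = ∑ i, ∑ j,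
      A (EuclideanSpace.single j 1) i * B (EuclideanSpace.single j 1) i := by
  rw [LinearMap.trace_eq_sum_inner _ (EuclideanSpace.basisFun (Fin n) ℝ), Finset.sum_comm]
  refine Finset.sum_congr rfl fun j _ => ?_
  rw [LinearMap.comp_apply, ← hA, PiLp.inner_apply]
  simp [mul_comm]

lemma inner_apply_eq_sum_apply_single
    (A : EuclideanSpace ℝ (Fin n) →ₗ[ℝ] EuclideanSpace ℝ (Fin n))
    (v : EuclideanSpace ℝ (Fin n)) :
    ⟪v, A v⟫ = ∑ i, ∑ j, A (EuclideanSpace.single j 1) i * v i * v j := by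
  have hv : A v = ∑ j, v j • A (EuclideanSpace.single j 1) := by
    conv_lhs => rw [← (EuclideanSpace.basisFun (Fin n) ℝ).sum_repr v]
    simp
  rw [hv, PiLp.inner_apply]
  refine Finset.sum_congr rfl fun i _ => ?_
  simp [Finset.sum_mul]
  exact Finset.sum_congr rfl fun j _ => by ring

end Coordinates

section Homogeneous

variable {E : Type*} [NormedAddCommGroup E] [InnerProductSpace ℝ E] [CompleteSpace E]
  {h : E → ℝ}

lemma inner_gradient_self_of_homogeneous (hh : ∀ (t : ℝ) x, h (t • x) = t ^ 2 * h x) {x : E}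
    (hd : DifferentiableAt ℝ h x) : ⟪gradient h x, x⟫ = 2 * h x := by
  rw [inner_gradient_left]
  have hline : HasDerivAt (fun t : ℝ => t • x) x 1 := by
    simpa using (hasDerivAt_id (1 : ℝ)).smul_const x
  have h1 : HasDerivAt (fun t : ℝ => h (t • x)) (fderiv ℝ h x x) 1 :=
    HasFDerivAt.comp_hasDerivAt (f := fun t : ℝ => t • x) 1 (by simpa using hd.hasFDerivAt) hline
  have h2 : HasDerivAt (fun t : ℝ => h (t • x)) (2 * h x) 1 := by
    simp only [hh]
    simpa using (hasDerivAt_pow 2 (1 : ℝ)).mul_const (h x)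
  exact h1.unique h2

lemma gradient_smul_of_homogeneous (hh : ∀ (t : ℝ) x, h (t • x) = t ^ 2 * h x) {t : ℝ}
    (ht : t ≠ 0) (x : E) : gradient h (t • x) = t • gradient h x := by
  refine ext_inner_right ℝ fun v => ?_
  rw [real_inner_smul_left, inner_gradient_left, inner_gradient_left]
  have h1 : t • fderiv ℝ h (t • x) = t ^ 2 • fderiv ℝ h x := by
    have hfun : (fun y => h (t • y)) = t ^ 2 • h := funext fun y => by simp [hh]
    rw [← fderiv_comp_smul, hfun, fderiv_const_smul_field, Pi.smul_apply]
  have h2 := congrArg (fun L : E →L[ℝ] ℝ => L v) h1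
  simp only [smul_apply, smul_eq_mul] at h2
  exact mul_left_cancel₀ ht (by linarith)

lemma fderiv_gradient_self_of_homogeneous (hh : ∀ (t : ℝ) x, h (t • x) = t ^ 2 * h x) {x : E}
    (hd : DifferentiableAt ℝ (gradient h) x) : fderiv ℝ (gradient h) x x = gradient h x := by
  have hline : HasDerivAt (fun t : ℝ => t • x) x 1 := by
    simpa using (hasDerivAt_id (1 : ℝ)).smul_const x
  have h1 : HasDerivAt (fun t : ℝ => gradient h (t • x)) (fderiv ℝ (gradient h) x x) 1 :=
    HasFDerivAt.comp_hasDerivAt (l := gradient h) (l' := fderiv ℝ (gradient h) x) (f := fun t : ℝ => t • x) 1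
      (by simpa using hd.hasFDerivAt) hline
  have h2 : HasDerivAt (fun t : ℝ => t • gradient h x) (gradient h x) 1 := by
    simpa using (hasDerivAt_id (1 : ℝ)).smul_const (gradient h x)
  refine h1.unique (h2.congr_of_eventuallyEq ?_)
  filter_upwards [isOpen_ne.mem_nhds (one_ne_zero (α := ℝ))] with t ht
  exact gradient_smul_of_homogeneous hh ht x

end Homogeneous

section Eikonal

variable {E : Type*} [NormedAddCommGroup E] [InnerProductSpace ℝ E] [CompleteSpace E]
  {F : E → ℝ} {lam : ℝ} {u : E → ℝ} {x : E}

/-- The derivative of `F(∇u)` dictated by the first integral `F(∇u)² + λu² = λ`. -/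
lemma hasFDerivAt_comp_gradient_of_first_integral
    (hFu : DifferentiableAt ℝ (fun y => F (gradient u y)) x) (hu : DifferentiableAt ℝ u x)
    (hne : F (gradient u x) ≠ 0)
    (hP : ∀ᶠ y in nhds x, F (gradient u y) ^ 2 + lam * u y ^ 2 = lam) :
    HasFDerivAt (fun y => F (gradient u y))
      (-(lam * u x / F (gradient u x)) • innerSL ℝ (gradient u x)) x := by
  have h1 := (hFu.hasFDerivAt.pow 2).add ((hu.hasFDerivAt.pow 2).const_mul lam)
  have h2 := h1.unique ((hasFDerivAt_const lam x).congr_of_eventuallyEq hP)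
  convert hFu.hasFDerivAt using 1
  ext v
  have h3 := congrArg (fun L : E →L[ℝ] ℝ => L v) h2
  simp at h3
  simp [inner_gradient_left]
  field_simp
  linarith

/-- Differentiating the first integral `F(∇u)² + λu² = λ` shows that the Hessian of `u` maps
`∇(F²/2)(∇u)` to `-λu∇u`. -/
lemma fderiv_gradient_apply_gradient_of_first_integral
    (hF : DifferentiableAt ℝ (fun η => F η ^ 2 / 2) (gradient u x)) (hu : ContDiffAt ℝ 2 u x)
    (hP : ∀ᶠ y in nhds x, F (gradient u y) ^ 2 + lam * u y ^ 2 = lam) :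
    fderiv ℝ (gradient u) x (gradient (fun η => F η ^ 2 / 2) (gradient u x)) =
      -(lam * u x) • gradient u x := by
  have hud : DifferentiableAt ℝ u x := hu.differentiableAt two_ne_zero
  have hgd : DifferentiableAt ℝ (gradient u) x :=
    (InnerProductSpace.toDual ℝ E).symm.toContinuousLinearEquiv.differentiableAt.comp x
      ((hu.fderiv_right (m := 1) le_rfl).differentiableAt one_ne_zero)
  refine ext_inner_right ℝ fun v => ?_
  have hsymm := isSymmetric_fderiv_gradient hu (gradient (fun η => F η ^ 2 / 2) (gradient u x)) v
  simp only [ContinuousLinearMap.coe_coe] at hsymm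
  rw [hsymm, inner_gradient_left, real_inner_smul_left, inner_gradient_left]
  have h1 := (hF.hasFDerivAt.comp x hgd.hasFDerivAt).add
    ((hud.hasFDerivAt.pow 2).const_mul (lam / 2))
  have h2 := h1.unique ((hasFDerivAt_const (lam / 2) x).congr_of_eventuallyEq (by
    filter_upwards [hP] with y hy
    simp
    linarith))
  have h3 := congrArg (fun L : E →L[ℝ] ℝ => L v) h2
  simp at h3
  linarith

/-- The derivative of `F(∇u)⁻¹ • V`. -/
lemma hasFDerivAt_inv_smul_of_first_integral {V : E → E} {V' : E →L[ℝ] E}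
    (hV : HasFDerivAt V V' x) (hne : F (gradient u x) ≠ 0)
    (hφ : HasFDerivAt (fun y => F (gradient u y))
      (-(lam * u x / F (gradient u x)) • innerSL ℝ (gradient u x)) x) :
    HasFDerivAt (fun y => (F (gradient u y))⁻¹ • V y)
      ((F (gradient u x))⁻¹ • V' + (lam * u x / F (gradient u x) ^ 3) •
        (innerSL ℝ (gradient u x)).smulRight (V x)) x := by
  convert ((hasDerivAt_inv hne).comp_hasFDerivAt x hφ).smul hV using 1
  congr 1
  ext v
  simp [smul_smul]
  congr 1
  field_simp

end Eikonal

section Euclidean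

variable {n : ℕ} {F : EuclideanSpace ℝ (Fin n) → ℝ}

lemma IsStronglyConvexMinkowskiNormC3.contDiffOn_sq_div_two
    (hF : IsStronglyConvexMinkowskiNormC3 F) :
    ContDiffOn ℝ 3 (fun η => F η ^ 2 / 2) {(0 : EuclideanSpace ℝ (Fin n))}ᶜ :=
  (hF.contDiff3.pow 2).div_const 2

lemma IsMinkowskiNorm.sq_div_two_homogeneous (hF : IsMinkowskiNorm F) (t : ℝ)
    (ξ : EuclideanSpace ℝ (Fin n)) : F (t • ξ) ^ 2 / 2 = t ^ 2 * (F ξ ^ 2 / 2) := by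
  rw [hF.homog, mul_pow, sq_abs]; ring

end Euclidean

/-- Rigidity of the gradient direction: if `u` solves the eigenvalue equation with
`F(∇u)² + λu² ≡ λ` on a connected open set where `∇u ≠ 0`, then the Hessian of `u`
is `−λu X* ⊗ X*` with `X = ∇u/F(∇u)`, and `X` is a constant vector field. -/
theorem gradient_direction_rigidity {n : ℕ} (hn : 1 ≤ n)
    (F : EuclideanSpace ℝ (Fin n) → ℝ) (hF : IsStronglyConvexMinkowskiNormC3 F)
    (lam : ℝ) (hlam : 0 < lam)
    (U : Set (EuclideanSpace ℝ (Fin n))) (hUo : IsOpen U) (hUc : IsConnected U)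
    (u : EuclideanSpace ℝ (Fin n) → ℝ) (hu : ContDiffOn ℝ 2 u U)
    (hgrad : ∀ x ∈ U, gradient u x ≠ 0)
    (heqn : ∀ x ∈ U,
      ∑ i, ∑ j, aCoeff F i j (gradient u x) * pd (pd u i) j x = -lam * u x)
    (hP : ∀ x ∈ U, F (gradient u x) ^ 2 + lam * u x ^ 2 = lam) :
    (∀ x ∈ U, ∀ i j,
      pd (pd u i) j x = -lam * u x * pd u i x * pd u j x / F (gradient u x) ^ 2) ∧
    ∃ c : EuclideanSpace ℝ (Fin n), ∀ x ∈ U,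
      (F (gradient u x))⁻¹ • gradient u x = c := by
  set h : EuclideanSpace ℝ (Fin n) → ℝ := fun η => F η ^ 2 / 2 with hdef
  have hopen : IsOpen ({0}ᶜ : Set (EuclideanSpace ℝ (Fin n))) := isOpen_compl_singleton
  have hhom : ∀ (t : ℝ) ξ, h (t • ξ) = t ^ 2 * h ξ := hF.sq_div_two_homogeneous
  have hhC : ContDiffOn ℝ 3 h {0}ᶜ := hF.contDiffOn_sq_div_two
  have hgC : ContDiffOn ℝ 2 (gradient h) {0}ᶜ := hhC.gradient_of_isOpen hopen (by norm_num)
  have huC : ContDiffOn ℝ 1 (gradient u) U := hu.gradient_of_isOpen hUo (by norm_num)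
  have hmaps : Set.MapsTo (gradient u) U {0}ᶜ := fun x hx => hgrad x hx
  have hφC : ContDiffOn ℝ 1 (fun y => F (gradient u y)) U :=
    (hF.contDiff3.of_le (by norm_num)).comp huC hmaps
  have hGC : ContDiffOn ℝ 1 (fun y => gradient h (gradient u y)) U :=
    (hgC.of_le (by norm_num)).comp huC hmaps
  have hφpos : ∀ x ∈ U, 0 < F (gradient u x) := fun x hx => hF.pos _ (hgrad x hx)
  have hφinv : ContDiffOn ℝ 1 (fun y => (F (gradient u y))⁻¹) U :=
    hφC.inv fun x hx => (hφpos x hx).ne'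
  let A := fun x => fderiv ℝ (gradient h) (gradient u x)
  let B := fun x => (F (gradient u x))⁻¹ • fderiv ℝ (gradient u) x +
    (lam * u x / F (gradient u x) ^ 3) • (innerSL ℝ (gradient u x)).smulRight (gradient u x)
  have huAt : ∀ x ∈ U, ContDiffAt ℝ 2 u x := fun x hx => hu.contDiffAt (hUo.mem_nhds hx)
  have hhAt : ∀ x ∈ U, ContDiffAt ℝ 2 h (gradient u x) := fun x hx =>
    (hhC.contDiffAt (hopen.mem_nhds (hmaps hx))).of_le (by norm_num)
  have hgAt : ∀ x ∈ U, HasFDerivAt (gradient h) (A x) (gradient u x) := fun x hx =>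
    ((hgC.contDiffAt (hopen.mem_nhds (hmaps hx))).differentiableAt two_ne_zero).hasFDerivAt
  have hguAt : ∀ x ∈ U, HasFDerivAt (gradient u) (fderiv ℝ (gradient u) x) x := fun x hx =>
    ((huC.contDiffAt (hUo.mem_nhds hx)).differentiableAt one_ne_zero).hasFDerivAt
  have hAself : ∀ x ∈ U, A x (gradient u x) = gradient h (gradient u x) := fun x hx =>
    fderiv_gradient_self_of_homogeneous hhom (hgAt x hx).differentiableAt
  have hAsymm : ∀ x ∈ U, (A x).toLinearMap.IsSymmetric := fun x hx =>
    isSymmetric_fderiv_gradient (hhAt x hx)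
  have hHsymm : ∀ x ∈ U, (fderiv ℝ (gradient u) x).toLinearMap.IsSymmetric := fun x hx =>
    isSymmetric_fderiv_gradient (huAt x hx)
  have hcoeff : ∀ x ∈ U, ∀ i j,
      aCoeff F i j (gradient u x) = A x (EuclideanSpace.single j 1) i := fun x hx i j =>
    pd_pd_eq_fderiv_gradient (hhAt x hx) i j
  have hPev : ∀ x ∈ U, ∀ᶠ y in nhds x, F (gradient u y) ^ 2 + lam * u y ^ 2 = lam := fun x hx =>
    Filter.eventually_of_mem (hUo.mem_nhds hx) hP
  have hinner : ∀ x ∈ U, ⟪gradient u x, gradient h (gradient u x)⟫ = F (gradient u x) ^ 2 :=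
    fun x hx => by
      rw [real_inner_comm, inner_gradient_self_of_homogeneous hhom
        ((hhAt x hx).differentiableAt two_ne_zero), hdef]
      ring
  have hφ' : ∀ x ∈ U, HasFDerivAt (fun y => F (gradient u y))
      (-(lam * u x / F (gradient u x)) • innerSL ℝ (gradient u x)) x := fun x hx =>
    hasFDerivAt_comp_gradient_of_first_integral
      ((hφC.contDiffAt (hUo.mem_nhds hx)).differentiableAt one_ne_zero)
      ((huAt x hx).differentiableAt two_ne_zero) (hφpos x hx).ne' (hPev x hx)
  have hX' : ∀ x ∈ U, HasFDerivAt (fun y => (F (gradient u y))⁻¹ • gradient u y) (B x) x :=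
    fun x hx => hasFDerivAt_inv_smul_of_first_integral (hguAt x hx) (hφpos x hx).ne' (hφ' x hx)
  let Z := fun y => (F (gradient u y))⁻¹ • gradient h (gradient u y)
  have hZC : ContDiffOn ℝ 1 Z U := hφinv.smul hGC
  have hZ' : ∀ x ∈ U, fderiv ℝ Z x = (A x).comp (B x) := fun x hx => by
    have hd : HasFDerivAt Z _ x := hasFDerivAt_inv_smul_of_first_integral
      (HasFDerivAt.comp (g := gradient h) x (hgAt x hx) (hguAt x hx)) (hφpos x hx).ne' (hφ' x hx)
    rw [hd.fderiv]
    ext1 v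
    simp [B, hAself x hx]
  have hBZ : ∀ x ∈ U, B x (Z x) = 0 := fun x hx => by
    have hH := fderiv_gradient_apply_gradient_of_first_integral
      ((hhAt x hx).differentiableAt two_ne_zero) (huAt x hx) (hPev x hx)
    have hne := (hφpos x hx).ne'
    have hi := hinner x hx
    simp only [B, Z, add_apply, smul_apply, map_smul, ContinuousLinearMap.smulRight_apply,
      innerSL_apply_apply]
    rw [hH, hi, smul_smul, smul_smul, ← add_smul]
    refine smul_eq_zero_of_right _ ?_
    convert zero_smul ℝ (gradient u x) using 2
    field_simp
    ring
  have hgeo : ∀ x ∈ U, fderiv ℝ Z x (Z x) = 0 := fun x hx => by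
    rw [hZ' x hx, ContinuousLinearMap.comp_apply, hBZ x hx, map_zero]
  have hBsymm : ∀ x ∈ U, (B x).toLinearMap.IsSymmetric := fun x hx v w => by
    have hs := hHsymm x hx v w
    simp only [ContinuousLinearMap.coe_coe] at hs
    simp [B, inner_add_left, inner_add_right, real_inner_smul_left, real_inner_smul_right, hs]
    exact Or.inl (mul_comm _ _)
  have hdiv : ∀ x ∈ U, LinearMap.trace ℝ _ (fderiv ℝ Z x).toLinearMap = 0 := fun x hx => by
    have hAH : LinearMap.trace ℝ _ ((A x).toLinearMap ∘ₗ
        (fderiv ℝ (gradient u) x).toLinearMap) = -lam * u x := by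
      rw [trace_comp_eq_sum_apply_single (hAsymm x hx), ← heqn x hx]
      refine Finset.sum_congr rfl fun i _ => Finset.sum_congr rfl fun j _ => ?_
      rw [hcoeff x hx, pd_pd_eq_fderiv_gradient (huAt x hx)]
      rfl
    have hsplit : (fderiv ℝ Z x).toLinearMap =
        (F (gradient u x))⁻¹ • ((A x).toLinearMap ∘ₗ (fderiv ℝ (gradient u) x).toLinearMap) +
        (lam * u x / F (gradient u x) ^ 3) •
          (innerₗ _ (gradient u x)).smulRight (gradient h (gradient u x)) := by
      rw [hZ' x hx]
      ext1 v
      simp [B, hAself x hx]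
    have hne := (hφpos x hx).ne'
    rw [hsplit, map_add, map_smul, map_smul, hAH, LinearMap.trace_smulRight, innerₗ_apply_apply,
      hinner x hx, smul_eq_mul, smul_eq_mul]
    field_simp
    ring
  have hB0 : ∀ x ∈ U, B x = 0 := fun x hx => by
    have htr := trace_fderiv_comp_fderiv_eq_zero hUo hZC hgeo hdiv hx
    rw [hZ' x hx] at htr
    have hpos : ∀ v, v ≠ 0 → 0 < ⟪v, A x v⟫ := fun v hv => by
      have hsum := inner_apply_eq_sum_apply_single (A x).toLinearMap v
      simp only [ContinuousLinearMap.coe_coe] at hsum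
      rw [hsum]
      simpa only [hcoeff x hx] using
        hF.posDef _ (hgrad x hx) v hv
    exact ContinuousLinearMap.coe_injective
      ((hAsymm x hx).eq_zero_of_trace_sq_comp_eq_zero hpos (hBsymm x hx) htr)
  refine ⟨fun x hx i j => ?_, ?_⟩
  · rw [pd_pd_eq_fderiv_gradient (huAt x hx), ← gradient_apply_eq_pd, ← gradient_apply_eq_pd]
    have hb := congrArg (fun L : EuclideanSpace ℝ (Fin n) →L[ℝ] EuclideanSpace ℝ (Fin n) =>
      L (EuclideanSpace.single j 1) i) (hB0 x hx)
    have hne := (hφpos x hx).ne'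
    simp [B] at hb
    rw [show fderiv ℝ u x (EuclideanSpace.single j 1) = gradient u x j from
      (gradient_apply_eq_pd u x j).symm] at hb
    field_simp at hb ⊢
    linarith
  · exact hUo.exists_is_const_of_fderiv_eq_zero hUc.isPreconnected
      (fun x hx => (hX' x hx).differentiableAt.differentiableWithinAt)
      (fun x hx => (hX' x hx).fderiv.trans (hB0 x hx))
end
end
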